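/- arXiv:2007.00379 — 4 statements merged into one kernel-verified Lean document; each statement's English description precedes it below -/
import Mathlib

section
/- (Theorem 1.1, part A, relation (1.8).) Assume V_i ≥ 0 for all i ≥ 1 and V_1 > 0, and that H(u) < ∞ for all u ∈ [0, u_0). Let χ > 0 and suppose u ∈ (0, u_0) satisfies the Lambert-type equation u·H'(u) = 1/χ. Then for every sequence (x_k)_{k≥1} of positive reals with x_k/k → χ as k → ∞, one has (1/k)·ln( M_k(x_k)/x_k^k ) → (H(u) − 1)/(u·H'(u)) − 1 + ln H'(u) as k → ∞. -/
open scoped BigOperators ENNReal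
open Filter MeasureTheory

noncomputable section

/-- The finset of tuples `(l 0, ..., l (k-1))` (representing `l_1, ..., l_k`) of nonnegative
integers with `l_1 + 2 l_2 + ⋯ + k l_k = k`. -/
def bellTuples (k : ℕ) : Finset (Fin k → ℕ) :=
  (Fintype.piFinset fun _ => Finset.range (k + 1)).filter
    (fun l => ∑ i, (i.1 + 1) * l i = k)

/-- Weighted Bell polynomial `M_k(x)` for weights `V_1, V_2, …`. -/
def weightedBell (V : ℕ → ℝ) (k : ℕ) (x : ℝ) : ℝ :=
  (Nat.factorial k : ℝ) * ∑ l ∈ bellTuples k, ∏ i : Fin k,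
    (x * V (i.1 + 1)) ^ (l i) /
      ((Nat.factorial (i.1 + 1) : ℝ) ^ (l i) * (Nat.factorial (l i) : ℝ))

/-- Exponential generating function `H(u) = 1 + ∑_{i ≥ 1} V_i u^i / i!` of the weights. -/
def weightEGF (V : ℕ → ℝ) (u : ℝ) : ℝ :=
  1 + ∑' i : ℕ, V (i + 1) * u ^ (i + 1) / (Nat.factorial (i + 1) : ℝ)

/-- Termwise derivative `H'(u) = ∑_{i ≥ 1} V_i u^{i-1}/(i-1)!`. -/
def weightEGFDeriv (V : ℕ → ℝ) (u : ℝ) : ℝ :=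
  ∑' i : ℕ, V (i + 1) * u ^ i / (Nat.factorial i : ℝ)

/-- Termwise second derivative `H''(u)`. -/
def weightEGFDeriv2 (V : ℕ → ℝ) (u : ℝ) : ℝ :=
  ∑' i : ℕ, V (i + 2) * u ^ i / (Nat.factorial i : ℝ)

/-- `H(u) < ∞` for all `u ∈ [0, u_0)`. -/
def HFinite (V : ℕ → ℝ) (u0 : ℝ≥0∞) : Prop :=
  ∀ u : ℝ, 0 ≤ u → ENNReal.ofReal u < u0 →
    Summable (fun i : ℕ => V (i + 1) * u ^ (i + 1) / (Nat.factorial (i + 1) : ℝ))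

theorem tendsto_log_factorial_div_sub_log :
    Tendsto (fun n : ℕ => Real.log (n.factorial : ℝ) / n - Real.log n) atTop (nhds (-1)) := by
  have hs : Tendsto (fun n : ℕ => Real.log (Stirling.stirlingSeq n)) atTop
      (nhds (Real.log (Real.sqrt Real.pi))) :=
    Stirling.tendsto_stirlingSeq_sqrt_pi.log (by positivity)
  have h1 := hs.mul tendsto_inv_atTop_nhds_zero_nat
  have h2 : Tendsto (fun n : ℕ => Real.log (2 * n) / (2 * n)) atTop (nhds 0) := by
    have h := Real.isLittleO_log_id_atTop.tendsto_div_nhds_zero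
    exact h.comp (tendsto_natCast_atTop_atTop.const_mul_atTop (by norm_num : (0 : ℝ) < 2))
  have h3 := (h1.add h2).sub_const 1
  rw [mul_zero, zero_add, zero_sub] at h3
  refine h3.congr' ?_
  filter_upwards [eventually_gt_atTop 0] with n hn
  have hn' : (0 : ℝ) < n := by exact_mod_cast hn
  rw [Stirling.log_stirlingSeq_formula, Real.log_div hn'.ne' (Real.exp_ne_zero _), Real.log_exp]
  field_simp
  ring

theorem tendsto_log_pow_div_factorial {c p a : ℝ} (hc : 0 < c) (hp : 0 < p) (ha : 0 < a)
    {y : ℕ → ℝ} (hy : Tendsto (fun k : ℕ => y k / k) atTop (nhds c))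
    {l : ℕ → ℕ} (hl : Tendsto (fun k : ℕ => (l k : ℝ) / k) atTop (nhds p)) :
    Tendsto (fun k : ℕ => 1 / (k : ℝ) * Real.log ((y k * a) ^ l k / (l k).factorial)) atTop
      (nhds (p * (Real.log (c * a / p) + 1))) := by
  have hlt : Tendsto l atTop atTop := by
    rw [← tendsto_natCast_atTop_iff (R := ℝ)]
    refine (hl.pos_mul_atTop hp tendsto_natCast_atTop_atTop).congr' ?_
    filter_upwards [eventually_gt_atTop 0] with k hk
    have : (0 : ℝ) < k := by exact_mod_cast hk
    field_simp
  have h1 := tendsto_log_factorial_div_sub_log.comp hlt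
  have h2 := ((hy.mul_const a).div hl hp.ne').log (by positivity)
  have h3 := hl.mul (h2.sub h1)
  rw [sub_neg_eq_add] at h3
  refine h3.congr' ?_
  filter_upwards [eventually_gt_atTop 0, hlt.eventually_gt_atTop 0, hy.eventually_const_lt hc]
    with k hk hlk hyk
  have hk' : (0 : ℝ) < k := by exact_mod_cast hk
  have hlk' : (0 : ℝ) < l k := by exact_mod_cast hlk
  have hy' : 0 < y k := (div_pos_iff_of_pos_right hk').1 hyk
  have hf : (0 : ℝ) < (l k).factorial := by positivity
  simp only [Function.comp, Pi.div_apply]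
  rw [Real.log_div (by positivity) hf.ne', Real.log_pow,
    show y k / k * a / (l k / k) = y k * a / l k by field_simp,
    Real.log_div (by positivity) hlk'.ne']
  field_simp
  ring

/-- The coefficient of `t ^ k` in `exp (y * ∑ i, a i * t ^ (i + 1))`. -/
def bellSum (a : ℕ → ℝ) (k : ℕ) (y : ℝ) : ℝ :=
  ∑ l ∈ bellTuples k, ∏ i : Fin k, (y * a i) ^ l i / (l i).factorial

theorem weightedBell_eq_factorial_mul_bellSum (V : ℕ → ℝ) (k : ℕ) (y : ℝ) :
    weightedBell V k y =
      k.factorial * bellSum (fun i => V (i + 1) / (i + 1).factorial) k y := by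
  unfold weightedBell bellSum
  congr 1
  refine Finset.sum_congr rfl fun l _ => Finset.prod_congr rfl fun i _ => ?_
  rw [← mul_div_assoc, div_pow, div_div]

theorem bellSum_mul_pow_le_exp {a : ℕ → ℝ} (ha : ∀ i, 0 ≤ a i) {u E y : ℝ} (hu : 0 ≤ u)
    (hy : 0 ≤ y) (hE : HasSum (fun i => a i * u ^ (i + 1)) E) (k : ℕ) :
    bellSum a k y * u ^ k ≤ Real.exp (y * E) := by
  have hnn : ∀ i, 0 ≤ y * (a i * u ^ (i + 1)) := fun i => by have := ha i; positivity
  calc bellSum a k y * u ^ k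
      = ∑ l ∈ bellTuples k, ∏ i : Fin k,
          (y * (a i * u ^ (i.1 + 1))) ^ l i / (l i).factorial := by
        rw [bellSum, Finset.sum_mul]
        refine Finset.sum_congr rfl fun l hl => ?_
        have hk : ∑ i, (i.1 + 1) * l i = k := (Finset.mem_filter.1 hl).2
        rw [show u ^ k = ∏ i : Fin k, (u ^ (i.1 + 1)) ^ l i by
          simp_rw [← pow_mul]; rw [Finset.prod_pow_eq_pow_sum, hk], ← Finset.prod_mul_distrib]
        refine Finset.prod_congr rfl fun i _ => ?_
        rw [← mul_assoc, mul_pow (y * a i)]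
        ring
    _ ≤ ∑ l ∈ Fintype.piFinset fun _ : Fin k => Finset.range (k + 1), ∏ i : Fin k,
          (y * (a i * u ^ (i.1 + 1))) ^ l i / (l i).factorial := by
        refine Finset.sum_le_sum_of_subset_of_nonneg (Finset.filter_subset _ _) fun l _ _ => ?_
        exact Finset.prod_nonneg fun i _ =>
          div_nonneg (pow_nonneg (hnn i) _) (Nat.cast_nonneg _)
    _ = ∏ i : Fin k, ∑ n ∈ Finset.range (k + 1),
          (y * (a i * u ^ (i.1 + 1))) ^ n / n.factorial := by
        rw [Finset.prod_univ_sum]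
    _ ≤ ∏ i : Fin k, Real.exp (y * (a i * u ^ (i.1 + 1))) := by
        refine Finset.prod_le_prod (fun i _ => Finset.sum_nonneg fun n _ =>
          div_nonneg (pow_nonneg (hnn i) _) (Nat.cast_nonneg _)) fun i _ => ?_
        exact Real.sum_le_exp_of_nonneg (hnn i) _
    _ = Real.exp (y * ∑ i ∈ Finset.range k, a i * u ^ (i + 1)) := by
        rw [← Real.exp_sum, Finset.mul_sum,
          Finset.sum_range (fun i => y * (a i * u ^ (i + 1)))]
    _ ≤ Real.exp (y * E) := by
        gcongr
        exact sum_le_hasSum _ (fun i _ => by have := ha i; positivity) hE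

theorem prod_le_bellSum {a : ℕ → ℝ} (ha : ∀ i, 0 ≤ a i) {y : ℝ} (hy : 0 ≤ y) {k : ℕ}
    {l : ℕ → ℕ} (hl : ∑ i ∈ Finset.range k, (i + 1) * l i = k) :
    ∏ i ∈ Finset.range k, (y * a i) ^ l i / (l i).factorial ≤ bellSum a k y := by
  rw [Finset.prod_range (fun i => (y * a i) ^ l i / ((l i).factorial : ℝ))]
  refine Finset.single_le_sum
    (f := fun l : Fin k → ℕ => ∏ i : Fin k, (y * a i) ^ l i / ((l i).factorial : ℝ))
    (a := fun i : Fin k => l i) (fun l _ => Finset.prod_nonneg fun i _ => ?_) ?_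
  · have := ha i
    positivity
  · refine Finset.mem_filter.2 ⟨Fintype.mem_piFinset.2 fun i => Finset.mem_range.2 ?_, ?_⟩
    · have h := Finset.single_le_sum (f := fun i => (i + 1) * l i) (fun _ _ => Nat.zero_le _)
        (Finset.mem_range.2 i.2)
      rw [hl] at h
      nlinarith [Nat.zero_le (i.1 * l i)]
    · rw [← Finset.sum_range (fun i => (i + 1) * l i), hl]

theorem prod_mul_le_bellSum {a : ℕ → ℝ} (ha : ∀ i, 0 ≤ a i) {y : ℝ} (hy : 0 ≤ y) {k N n : ℕ}
    (hk : N + 1 ≤ k) {m : ℕ → ℕ} (hn : n + ∑ j ∈ Finset.range N, (j + 2) * m j = k) :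
    (y * a 0) ^ n / n.factorial *
      ∏ j ∈ Finset.range N, (y * a (j + 1)) ^ m j / (m j).factorial ≤ bellSum a k y := by
  let l : ℕ → ℕ := fun i => Nat.casesOn i n fun j => if j < N then m j else 0
  have hout : ∀ i, i ∉ Finset.range (N + 1) → l i = 0 := by
    rintro (_ | j) hi
    · simp at hi
    · have : ¬ j < N := by simpa using hi
      simp [l, this]
  have hsub : Finset.range (N + 1) ⊆ Finset.range k := by simpa using hk
  have hl : ∑ i ∈ Finset.range k, (i + 1) * l i = k := by
    rw [← Finset.sum_subset hsub fun i _ hi => by rw [hout i hi, mul_zero],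
      Finset.sum_range_succ']
    conv_rhs => rw [← hn]
    rw [add_comm]
    congr 1
    · simp [l]
    · refine Finset.sum_congr rfl fun j hj => ?_
      simp [l, Finset.mem_range.1 hj]
  refine le_trans (le_of_eq ?_) (prod_le_bellSum ha hy hl)
  rw [← Finset.prod_subset hsub fun i _ hi => by rw [hout i hi]; simp,
    Finset.prod_range_succ', mul_comm]
  congr 1
  refine Finset.prod_congr rfl fun j hj => ?_
  simp [l, Finset.mem_range.1 hj]

theorem eventually_lt_log_bellSum {a : ℕ → ℝ} (ha : ∀ i, 0 ≤ a i) (ha0 : 0 < a 0) {χ : ℝ}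
    (hχ : 0 < χ) {x : ℕ → ℝ} (hx : ∀ k, 0 < x k)
    (hxχ : Tendsto (fun k : ℕ => x k / k) atTop (nhds χ)) {p : ℕ → ℝ} (hp : ∀ j, 0 ≤ p j)
    (hpa : ∀ j, a (j + 1) = 0 → p j = 0) {N : ℕ} {q : ℝ}
    (hq : q = 1 - ∑ j ∈ Finset.range N, (j + 2) * p j) (hq0 : 0 < q) {c : ℝ}
    (hc : c < q * (Real.log (χ * a 0 / q) + 1) +
      ∑ j ∈ Finset.range N, p j * (Real.log (χ * a (j + 1) / p j) + 1)) :
    ∀ᶠ k : ℕ in atTop, c < 1 / (k : ℝ) * Real.log (bellSum a k (x k)) := by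
  let m : ℕ → ℕ → ℕ := fun k j => ⌊p j * k⌋₊
  let n : ℕ → ℕ := fun k => k - ∑ j ∈ Finset.range N, (j + 2) * m k j
  have hm : ∀ j, Tendsto (fun k : ℕ => (m k j : ℝ) / k) atTop (nhds (p j)) := fun j =>
    (tendsto_nat_floor_mul_div_atTop (hp j)).comp tendsto_natCast_atTop_atTop
  have hle : ∀ k, ∑ j ∈ Finset.range N, (j + 2) * m k j ≤ k := fun k => by
    have h : ∑ j ∈ Finset.range N, ((j : ℝ) + 2) * m k j ≤ (1 - q) * k := by
      rw [hq, sub_sub_cancel, Finset.sum_mul]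
      refine Finset.sum_le_sum fun j _ => ?_
      rw [mul_assoc]
      gcongr
      exact Nat.floor_le (mul_nonneg (hp j) (Nat.cast_nonneg _))
    have h' : (1 - q) * (k : ℝ) ≤ k := by nlinarith [(Nat.cast_nonneg k : (0 : ℝ) ≤ k)]
    exact_mod_cast h.trans h'
  have hn : Tendsto (fun k : ℕ => (n k : ℝ) / k) atTop (nhds q) := by
    have h : Tendsto (fun k : ℕ => 1 - ∑ j ∈ Finset.range N, ((j : ℝ) + 2) * (m k j / k)) atTop
        (nhds q) := by
      rw [hq]
      exact (tendsto_finsetSum _ fun j _ => (hm j).const_mul _).const_sub _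
    refine h.congr' ?_
    filter_upwards [eventually_gt_atTop 0] with k hk
    have hk' : (0 : ℝ) < k := by exact_mod_cast hk
    simp only [n]
    rw [Nat.cast_sub (hle k), sub_div, div_self hk'.ne']
    push_cast
    rw [Finset.sum_div]
    simp_rw [mul_div_assoc]
  have hlog : ∀ j, Tendsto (fun k : ℕ => 1 / (k : ℝ) *
      Real.log ((x k * a (j + 1)) ^ m k j / (m k j).factorial)) atTop
      (nhds (p j * (Real.log (χ * a (j + 1) / p j) + 1))) := fun j => by
    rcases (hp j).eq_or_lt with h | h
    · simp [m, ← h]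
    · refine tendsto_log_pow_div_factorial hχ h ?_ hxχ (hm j)
      exact (ha _).lt_of_ne' fun h0 => h.ne' (hpa j h0)
  have key := (tendsto_log_pow_div_factorial hχ hq0 ha0 hxχ hn).add
    (tendsto_finsetSum (Finset.range N) fun j _ => hlog j)
  filter_upwards [key.eventually_const_lt hc, eventually_ge_atTop (N + 1)] with k hk hkN
  refine hk.trans_le ?_
  have hpos : ∀ j, 0 < (x k * a (j + 1)) ^ m k j / ((m k j).factorial : ℝ) := fun j => by
    refine div_pos ?_ (by positivity)
    rcases (hp j).eq_or_lt with h | h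
    · simp [m, ← h]
    · exact pow_pos (mul_pos (hx k) ((ha _).lt_of_ne' fun h0 => h.ne' (hpa j h0))) _
  have hpos0 : 0 < (x k * a 0) ^ n k / ((n k).factorial : ℝ) :=
    div_pos (pow_pos (mul_pos (hx k) ha0) _) (by positivity)
  rw [← Finset.mul_sum, ← mul_add, ← Real.log_prod (fun j _ => (hpos j).ne'),
    ← Real.log_mul hpos0.ne' (Finset.prod_pos fun j _ => hpos j).ne']
  gcongr
  · exact mul_pos hpos0 (Finset.prod_pos fun j _ => hpos j)
  · exact prod_mul_le_bellSum ha (hx k).le hkN (Nat.sub_add_cancel (hle k))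

theorem bellSum_pos {a : ℕ → ℝ} (ha : ∀ i, 0 ≤ a i) (ha0 : 0 < a 0) {y : ℝ} (hy : 0 < y)
    {k : ℕ} (hk : 1 ≤ k) : 0 < bellSum a k y := by
  have h := prod_mul_le_bellSum ha hy.le (N := 0) (n := k) (m := 0) hk (by simp)
  refine lt_of_lt_of_le ?_ h
  simp only [Finset.range_zero, Finset.prod_empty, mul_one]
  positivity

theorem tendsto_log_bellSum {a : ℕ → ℝ} (ha : ∀ i, 0 ≤ a i) (ha0 : 0 < a 0) {χ u E : ℝ}
    (hχ : 0 < χ) (hu : 0 < u) (hE : HasSum (fun i => a i * u ^ (i + 1)) E)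
    (hmean : HasSum (fun i : ℕ => (i + 1) * (χ * (a i * u ^ (i + 1)))) 1)
    {x : ℕ → ℝ} (hx : ∀ k, 0 < x k)
    (hxχ : Tendsto (fun k : ℕ => x k / k) atTop (nhds χ)) :
    Tendsto (fun k : ℕ => 1 / (k : ℝ) * Real.log (bellSum a k (x k))) atTop
      (nhds (χ * E - Real.log u)) := by
  refine tendsto_order.2 ⟨fun c hc => ?_, fun c hc => ?_⟩
  · let p : ℕ → ℝ := fun i => χ * (a i * u ^ (i + 1))
    have hp : ∀ i, 0 ≤ p i := fun i => by have := ha i; positivity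
    have hp0 : 0 < p 0 := by positivity
    let q : ℕ → ℝ := fun N => 1 - ∑ j ∈ Finset.range N, ((j : ℝ) + 2) * p (j + 1)
    have hS : HasSum (fun j : ℕ => ((j : ℝ) + 2) * p (j + 1)) (1 - p 0) := by
      have h := (hasSum_nat_add_iff' 1).2 hmean
      simp only [Finset.sum_range_one, Nat.cast_add, Nat.cast_one, Nat.cast_zero, zero_add,
        one_mul, add_assoc, one_add_one_eq_two] at h
      simpa [p, add_assoc, one_add_one_eq_two] using h
    have hP : HasSum (fun j : ℕ => p (j + 1)) (χ * E - p 0) := by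
      have h := (hasSum_nat_add_iff' 1).2 (hE.mul_left χ)
      simpa [p] using h
    have hqt : Tendsto q atTop (nhds (p 0)) := by
      have h := hS.tendsto_sum_nat.const_sub 1
      rwa [sub_sub_cancel] at h
    have hqpos : ∀ N, 0 < q N := fun N => by
      have h := sum_le_hasSum (Finset.range N)
        (fun j _ => mul_nonneg (by positivity) (hp (j + 1))) hS
      simp only [q]
      linarith
    have hterm : ∀ j, p (j + 1) * (Real.log (χ * a (j + 1) / p (j + 1)) + 1) =
        p (j + 1) - Real.log u * ((j + 2) * p (j + 1)) := fun j => by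
      rcases (ha (j + 1)).eq_or_lt with h | h
      · simp [p, ← h]
      · rw [show χ * a (j + 1) / p (j + 1) = (u ^ (j + 2))⁻¹ by simp only [p]; field_simp,
          Real.log_inv, Real.log_pow]
        push_cast
        ring
    have hlim : Tendsto (fun N => q N * (Real.log (χ * a 0 / q N) + 1) +
        ∑ j ∈ Finset.range N, p (j + 1) * (Real.log (χ * a (j + 1) / p (j + 1)) + 1)) atTop
        (nhds (χ * E - Real.log u)) := by
      have h1 := hqt.mul ((((tendsto_const_nhds (x := χ * a 0)).div hqt hp0.ne').log (by positivity)).add_const 1)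
      have h2 := (hP.sub (hS.mul_left (Real.log u))).tendsto_sum_nat
      simp_rw [hterm]
      have hval : χ * E - Real.log u = p 0 * (Real.log (χ * a 0 / p 0) + 1) +
          (χ * E - p 0 - Real.log u * (1 - p 0)) := by
        rw [show χ * a 0 / p 0 = u⁻¹ by simp only [p]; field_simp; simp, Real.log_inv]
        ring
      rw [hval]
      exact h1.add h2
    obtain ⟨N, hN⟩ := (hlim.eventually_const_lt hc).exists
    refine eventually_lt_log_bellSum ha ha0 hχ hx hxχ (p := fun j => p (j + 1))
      (fun j => hp _) (fun j h => ?_) rfl (hqpos N) hN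
    simp [p, h]
  · have h := (hxχ.mul_const E).sub_const (Real.log u)
    filter_upwards [h.eventually_lt_const hc, eventually_ge_atTop 1] with k hk hk1
    refine lt_of_le_of_lt ?_ hk
    have hk' : (0 : ℝ) < k := by exact_mod_cast hk1
    have hb := bellSum_pos ha ha0 (hx k) hk1
    have hle := Real.log_le_log (by positivity) (bellSum_mul_pow_le_exp ha hu.le (hx k).le hE k)
    rw [Real.log_exp, Real.log_mul hb.ne' (by positivity), Real.log_pow] at hle
    rw [one_div_mul_eq_div, div_le_iff₀ hk']
    field_simp
    linarith

/-- Theorem 1.1, part A, relation (1.8): the rate function of the weighted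
Bell polynomials in the regime `x_k / k → χ`. -/
theorem stmt2 (V : ℕ → ℝ) (hVpos : ∀ i : ℕ, 1 ≤ i → 0 ≤ V i) (hV1 : 0 < V 1)
    (u0 : ℝ≥0∞) (hu0 : 0 < u0) (hH : HFinite V u0)
    (χ : ℝ) (hχ : 0 < χ)
    (u : ℝ) (hu : 0 < u) (huu0 : ENNReal.ofReal u < u0)
    (hLambert : u * weightEGFDeriv V u = 1 / χ)
    (x : ℕ → ℝ) (hx : ∀ k, 0 < x k)
    (hxχ : Tendsto (fun k : ℕ => x k / (k : ℝ)) atTop (nhds χ)) :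
    Tendsto (fun k : ℕ => (1 / (k : ℝ)) * Real.log (weightedBell V k (x k) / (x k) ^ k))
      atTop (nhds ((weightEGF V u - 1) / (u * weightEGFDeriv V u) - 1 +
        Real.log (weightEGFDeriv V u))) := by
  have hD0 : weightEGFDeriv V u ≠ 0 := fun h => by
    rw [h, mul_zero] at hLambert
    exact (one_div_pos.2 hχ).ne hLambert
  have hD : weightEGFDeriv V u = 1 / (χ * u) := by
    field_simp at hLambert ⊢
    linarith
  have hsum : HasSum (fun i : ℕ => V (i + 1) * u ^ i / (i.factorial : ℝ))
      (weightEGFDeriv V u) := by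
    refine Summable.hasSum ?_
    by_contra h
    exact hD0 (tsum_eq_zero_of_not_summable h)
  have hE : HasSum (fun i : ℕ => V (i + 1) / ((i + 1).factorial : ℝ) * u ^ (i + 1))
      (weightEGF V u - 1) := by
    have h := (hH u hu.le huu0).hasSum
    simp only [weightEGF, add_sub_cancel_left]
    simpa only [div_mul_eq_mul_div] using h
  have hmean : HasSum (fun i : ℕ => ((i : ℝ) + 1) *
      (χ * (V (i + 1) / ((i + 1).factorial : ℝ) * u ^ (i + 1)))) 1 := by
    have h := hsum.mul_left (χ * u)
    rw [show χ * u * weightEGFDeriv V u = 1 by rw [hD]; field_simp] at h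
    have hfun : (fun i : ℕ => ((i : ℝ) + 1) *
        (χ * (V (i + 1) / ((i + 1).factorial : ℝ) * u ^ (i + 1)))) =
        fun i : ℕ => χ * u * (V (i + 1) * u ^ i / (i.factorial : ℝ)) := by
      ext i
      rw [Nat.factorial_succ]
      push_cast
      field_simp
      ring
    rwa [hfun]
  have ha : ∀ i : ℕ, 0 ≤ V (i + 1) / ((i + 1).factorial : ℝ) := fun i =>
    div_nonneg (hVpos _ (Nat.le_add_left 1 i)) (Nat.cast_nonneg _)
  have ha0 : 0 < V (0 + 1) / ((0 + 1).factorial : ℝ) := by simpa using hV1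
  have hB := tendsto_log_bellSum (a := fun i => V (i + 1) / ((i + 1).factorial : ℝ))
    ha ha0 hχ hu hE hmean hx hxχ
  have hid : Tendsto (fun k : ℕ => (k : ℝ) / k) atTop (nhds 1) :=
    tendsto_const_nhds.congr' <| by
      filter_upwards [eventually_gt_atTop 0] with k hk
      rw [div_self (by exact_mod_cast hk.ne')]
  have hF := tendsto_log_pow_div_factorial hχ one_pos one_pos hxχ (l := fun k => k) hid
  have hlim := hB.sub hF
  have hval : (weightEGF V u - 1) / (u * weightEGFDeriv V u) - 1 +
      Real.log (weightEGFDeriv V u) =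
      χ * (weightEGF V u - 1) - Real.log u - 1 * (Real.log (χ * 1 / 1) + 1) := by
    rw [hLambert, hD, one_div (χ * u), Real.log_inv, Real.log_mul hχ.ne' hu.ne', mul_one, div_one]
    field_simp
    ring
  rw [hval]
  refine hlim.congr' ?_
  filter_upwards [eventually_ge_atTop 1] with k hk
  have hb := bellSum_pos (a := fun i => V (i + 1) / ((i + 1).factorial : ℝ)) ha ha0 (hx k) hk
  have hxk := hx k
  rw [weightedBell_eq_factorial_mul_bellSum, mul_one, ← mul_sub,
    ← Real.log_div hb.ne' (by positivity)]
  congr 2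
  field_simp

end
end

section
/- (Theorem 1.1, part A, relation (1.10).) Assume V_i ≥ 0 for all i ≥ 1 and V_1 > 0, and that H(u) < ∞ for all u ∈ [0, u_0). Let χ > 0, suppose u ∈ (0, u_0) satisfies u·H'(u) = 1/χ, and set x_k = χ·k for every k. Then M_k(x_k) · √(1 + χ·u²·H''(u)) / ( x_k·H'(u)·exp( (H(u) − 1)/(u·H'(u)) − 1 ) )^k → 1 as k → ∞. -/
open scoped BigOperators ENNReal
open Filter MeasureTheory

noncomputable section

theorem hasSum_mul_of_summable_norm {ι κ : Type*} {f : ι → ℂ} {g : κ → ℂ}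
    (hf : Summable fun i => ‖f i‖) (hg : Summable fun i => ‖g i‖) :
    HasSum (fun p : ι × κ => f p.1 * g p.2) ((∑' i, f i) * ∑' i, g i) := by
  rw [tsum_mul_tsum_of_summable_norm hf hg]
  exact (summable_mul_of_summable_norm hf hg).hasSum

theorem summable_norm_and_hasSum_prod_pi {n : ℕ} (f : Fin n → ℕ → ℂ)
    (hf : ∀ i, Summable fun m => ‖f i m‖) :
    Summable (fun l : Fin n → ℕ => ‖∏ i, f i (l i)‖) ∧
      HasSum (fun l : Fin n → ℕ => ∏ i, f i (l i)) (∏ i, ∑' m, f i m) := by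
  induction n with
  | zero =>
    refine ⟨Summable.of_finite, ?_⟩
    convert hasSum_fintype (fun l : Fin 0 → ℕ => ∏ i, f i (l i)) using 1
    simp
  | succ n ih =>
    obtain ⟨hs, ht⟩ := ih (fun i => f i.succ) (fun i => hf i.succ)
    have hs' := (hf 0).mul_norm hs
    have ht' := hasSum_mul_of_summable_norm (hf 0) hs
    rw [ht.tsum_eq] at ht'
    constructor
    · rw [← (Fin.consEquiv fun _ : Fin (n + 1) => ℕ).summable_iff]
      refine hs'.congr fun p => ?_
      simp [Fin.prod_univ_succ, Fin.consEquiv]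
    · rw [Fin.prod_univ_succ, ← (Fin.consEquiv fun _ : Fin (n + 1) => ℕ).hasSum_iff]
      convert ht' using 1
      funext p
      simp [Fin.prod_univ_succ, Fin.consEquiv]

theorem mem_bellTuples {k : ℕ} {l : Fin k → ℕ} :
    l ∈ bellTuples k ↔ ∑ i, (i.1 + 1) * l i = k := by
  simp only [bellTuples, Finset.mem_filter, Fintype.mem_piFinset, Finset.mem_range,
    and_iff_right_iff_imp]
  intro h i
  have := Finset.single_le_sum (f := fun i : Fin k => (i.1 + 1) * l i)
    (fun _ _ => Nat.zero_le _) (Finset.mem_univ i)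
  simp only [h] at this
  nlinarith [Nat.zero_le (i.1 * l i)]

theorem integral_exp_int_mul_I (n : ℤ) :
    ∫ θ in (-Real.pi)..Real.pi, Complex.exp (n * θ * Complex.I) =
      if n = 0 then 2 * (Real.pi : ℂ) else 0 := by
  split_ifs with h
  · simp [h]; ring
  · have hc : (n * Complex.I : ℂ) ≠ 0 := by simp [h]
    have := integral_exp_mul_complex (a := -Real.pi) (b := Real.pi) hc
    have e : ∀ θ : ℝ, (n * θ * Complex.I : ℂ) = n * Complex.I * θ := fun θ => by ring
    simp_rw [e, this]
    rw [div_eq_zero_iff]; left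
    rw [sub_eq_zero, Complex.exp_eq_exp_iff_exists_int]
    exact ⟨n, by push_cast; ring⟩

theorem integral_exp_trigPoly (k : ℕ) (b : ℕ → ℝ) :
    ∫ θ in (-Real.pi)..Real.pi,
      Complex.exp (∑ j ∈ Finset.range k, b j * Complex.exp ((j + 1) * θ * Complex.I)
        - k * θ * Complex.I) =
      2 * Real.pi * ((∑ l ∈ bellTuples k, ∏ i : Fin k,
        b i ^ l i / (Nat.factorial (l i) : ℝ) : ℝ) : ℂ) := by
  let f : ℝ → Fin k → ℕ → ℂ := fun θ i m =>
    (b i * Complex.exp ((i + 1) * θ * Complex.I)) ^ m / (Nat.factorial m : ℂ)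
  let c : (Fin k → ℕ) → ℝ := fun l => ∏ i : Fin k, b i ^ l i / (Nat.factorial (l i) : ℝ)
  let F : (Fin k → ℕ) → ℝ → ℂ := fun l θ =>
    c l * Complex.exp (((∑ i, (i.1 + 1) * l i : ℕ) - k : ℤ) * θ * Complex.I)
  have hF : ∀ l θ, F l θ = (∏ i, f θ i (l i)) * Complex.exp (-(k * θ * Complex.I)) := by
    intro l θ
    have : ∀ i, f θ i (l i) = (b i ^ l i / (Nat.factorial (l i) : ℝ) : ℝ) *
        Complex.exp (((i.1 + 1) * l i : ℕ) * θ * Complex.I) := by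
      intro i
      simp only [f]
      rw [mul_pow, ← Complex.exp_nat_mul]
      push_cast
      ring_nf
    simp only [F, c, this, Finset.prod_mul_distrib, ← Complex.exp_sum, mul_assoc,
      ← Complex.exp_add, Complex.ofReal_prod]
    congr 2
    push_cast
    simp only [← Finset.sum_mul]
    ring
  have hs : ∀ θ i, Summable fun m => ‖f θ i m‖ := fun θ i =>
    NormedSpace.norm_expSeries_div_summable _
  have hsum : ∀ θ, HasSum (fun l => F l θ)
      (Complex.exp (∑ j ∈ Finset.range k, b j * Complex.exp ((j + 1) * θ * Complex.I)
        - k * θ * Complex.I)) := by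
    intro θ
    have h := (summable_norm_and_hasSum_prod_pi (f θ) (hs θ)).2.mul_right
      (Complex.exp (-(k * θ * Complex.I)))
    simp only [← hF] at h
    convert! h using 1
    rw [sub_eq_add_neg, Complex.exp_add, Finset.sum_range, Complex.exp_sum]
    congr 1
    refine Finset.prod_congr rfl fun i _ => ?_
    have := (NormedSpace.expSeries_div_hasSum_exp
      (b i * Complex.exp ((i + 1) * θ * Complex.I) : ℂ)).tsum_eq
    rw [← Complex.exp_eq_exp_ℂ] at this
    exact this.symm
  have hnorm : ∀ l θ, ‖F l θ‖ = |c l| := by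
    intro l θ
    have : (((∑ i, (i.1 + 1) * l i : ℕ) - k : ℤ) * θ * Complex.I : ℂ) =
      ((((∑ i, (i.1 + 1) * l i : ℕ) - k : ℤ) * θ : ℝ) : ℂ) * Complex.I := by push_cast; ring
    simp only [F]
    rw [norm_mul, this, Complex.norm_exp_ofReal_mul_I, Complex.norm_real]
    simp
  have hc : Summable fun l => |c l| := by
    have h := ((summable_norm_and_hasSum_prod_pi (f 0) (hs 0)).2.mul_right
      (Complex.exp (-(k * (0 : ℝ) * Complex.I)))).summable.norm
    simpa only [← hF, hnorm] using h
  have hcont : ∀ l, Continuous (F l) := fun l => by fun_prop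
  have hint := intervalIntegral.hasSum_integral_of_dominated_convergence
    (μ := volume) (a := -Real.pi) (b := Real.pi) (F := F)
    (f := fun θ : ℝ => Complex.exp (∑ j ∈ Finset.range k,
      b j * Complex.exp ((j + 1) * θ * Complex.I) - k * θ * Complex.I))
    (fun l _ => |c l|) (fun l => (hcont l).aestronglyMeasurable)
    (fun l => ae_of_all _ fun θ _ => (hnorm l θ).le) (ae_of_all _ fun _ _ => hc)
    intervalIntegrable_const (ae_of_all _ fun θ _ => hsum θ)
  rw [← hint.tsum_eq, tsum_eq_sum (s := bellTuples k)]
  · rw [Complex.ofReal_sum, Finset.mul_sum]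
    refine Finset.sum_congr rfl fun l hl => ?_
    simp only [F]
    rw [intervalIntegral.integral_const_mul, integral_exp_int_mul_I, mem_bellTuples.1 hl]
    simp [c, mul_comm]
  · intro l hl
    rw [mem_bellTuples] at hl
    simp only [F]
    rw [intervalIntegral.integral_const_mul, integral_exp_int_mul_I, if_neg (by omega), mul_zero]

theorem norm_exp_mul_I_sub_one_sub_le (x : ℝ) :
    ‖Complex.exp (x * Complex.I) - 1 - x * Complex.I‖ ≤ 2 * x ^ 2 := by
  have hn : ‖(x * Complex.I : ℂ)‖ = |x| := by simp
  rcases le_total |x| 1 with h | h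
  · have := Complex.norm_exp_sub_one_sub_id_le (hn.le.trans h)
    rw [hn, sq_abs] at this
    nlinarith [sq_nonneg x]
  · have h1 : ‖Complex.exp (x * Complex.I) - 1‖ ≤ |x| := by
      simpa [mul_comm] using Real.norm_exp_I_mul_ofReal_sub_one_le (x := x)
    calc _ ≤ |x| + |x| := (norm_sub_le _ _).trans (by rw [hn]; gcongr)
      _ ≤ 2 * |x| ^ 2 := by nlinarith
      _ = _ := by rw [sq_abs]

theorem tendsto_mul_exp_div_sqrt (c : ℝ) :
    Tendsto (fun k : ℕ => (k : ℂ) * (Complex.exp ((c / √k : ℝ) * Complex.I) - 1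
      - (c / √k : ℝ) * Complex.I)) atTop (nhds (-(c ^ 2 / 2 : ℝ))) := by
  have hsq : Tendsto (fun k : ℕ => √(k : ℝ)) atTop atTop :=
    Real.tendsto_sqrt_atTop.comp tendsto_natCast_atTop_atTop
  have h0 : Tendsto (fun k : ℕ => |c| ^ 3 / √(k : ℝ)) atTop (nhds 0) :=
    Tendsto.div_atTop tendsto_const_nhds hsq
  rw [tendsto_iff_norm_sub_tendsto_zero]
  refine squeeze_zero' (Eventually.of_forall fun _ => norm_nonneg _) ?_ h0
  filter_upwards [hsq.eventually_ge_atTop (|c| + 1)] with k hk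
  have hpos : 0 < √(k : ℝ) := by linarith [abs_nonneg c]
  have hkk : √(k : ℝ) ^ 2 = k := Real.sq_sqrt (Nat.cast_nonneg k)
  set y : ℝ := c / √k with hy
  have hyabs : |y| = |c| / √k := by rw [hy, abs_div, abs_of_pos hpos]
  have hn : ‖(y * Complex.I : ℂ)‖ = |y| := by simp
  have hy1 : |y| ≤ 1 := by rw [hyabs, div_le_one hpos]; linarith
  have hky : (k : ℝ) * y ^ 2 = c ^ 2 := by
    rw [hy, div_pow, hkk]; rw [← hkk]; field_simp
  have hb := Complex.exp_bound (hn.le.trans hy1) (n := 3) (by norm_num)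
  have e : (k : ℂ) * (Complex.exp (y * Complex.I) - 1 - y * Complex.I) - -((c ^ 2 / 2 : ℝ) : ℂ)
      = k * (Complex.exp (y * Complex.I) -
        ∑ m ∈ Finset.range 3, (y * Complex.I) ^ m / (Nat.factorial m : ℂ)) := by
    rw [← hky]
    simp [Finset.sum_range_succ, mul_pow, Nat.factorial]
    ring
  rw [e, norm_mul, Complex.norm_natCast]
  rw [hn] at hb
  calc (k : ℝ) * _ ≤ k * (|y| ^ 3 * 1) := by
        refine mul_le_mul_of_nonneg_left (hb.trans ?_) (Nat.cast_nonneg k)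
        gcongr
        norm_num [Nat.factorial]
    _ = _ := by
        rw [hyabs, div_pow]
        field_simp
        rw [hkk, mul_comm]

/-- The exponent of the rescaled Fourier integrand, with the series truncated after `k` terms. -/
def truncatedPhase (a : ℕ → ℝ) (k : ℕ) (s : ℝ) : ℂ :=
  ∑' j : ℕ, (a j : ℂ) * (k * ((if j < k then Complex.exp (((j + 1) * s / √k : ℝ) * Complex.I)
    else 0) - 1 - ((j + 1) * s / √k : ℝ) * Complex.I))

theorem norm_truncatedPhase_term_le {a : ℕ → ℝ} (ha : ∀ j, 0 ≤ a j) {k : ℕ} (hk : 0 < k) (s : ℝ)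
    (j : ℕ) :
    ‖(a j : ℂ) * (k * ((if j < k then Complex.exp (((j + 1) * s / √k : ℝ) * Complex.I)
      else 0) - 1 - ((j + 1) * s / √k : ℝ) * Complex.I))‖ ≤
      (j + 1) ^ 2 * a j * (2 * s ^ 2 + 1 + |s|) := by
  have hk' : (0 : ℝ) < k := by exact_mod_cast hk
  have hpos : 0 < √(k : ℝ) := Real.sqrt_pos.2 hk'
  have hkk : √(k : ℝ) ^ 2 = k := Real.sq_sqrt hk'.le
  rw [norm_mul, Complex.norm_real, Real.norm_of_nonneg (ha j), norm_mul, Complex.norm_natCast]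
  have key : (k : ℝ) * ‖(if j < k then Complex.exp (((j + 1) * s / √k : ℝ) * Complex.I)
      else 0) - 1 - ((j + 1) * s / √k : ℝ) * Complex.I‖ ≤
      (j + 1) ^ 2 * (2 * s ^ 2 + 1 + |s|) := by
    split_ifs with h
    · calc (k : ℝ) * _ ≤ k * (2 * ((j + 1) * s / √k) ^ 2) := by
            gcongr; exact norm_exp_mul_I_sub_one_sub_le _
        _ = (j + 1) ^ 2 * (2 * s ^ 2) := by
            rw [div_pow, hkk]; field_simp
        _ ≤ _ := by gcongr; linarith [abs_nonneg s]
    · have hjk : (k : ℝ) ≤ j + 1 := by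
        have : k ≤ j + 1 := by omega
        exact_mod_cast this
      have hj1 : (1 : ℝ) ≤ j + 1 := by linarith [(Nat.cast_nonneg j : (0 : ℝ) ≤ j)]
      have hk1 : (1 : ℝ) ≤ k := by exact_mod_cast hk
      have hsk : √(k : ℝ) ≤ j + 1 := by
        nlinarith [Real.one_le_sqrt.2 hk1]
      calc (k : ℝ) * _ ≤ k * (1 + (j + 1) * |s| / √k) := by
            gcongr
            refine (norm_sub_le _ _).trans ?_
            rw [norm_mul, Complex.norm_real, Complex.norm_I, Real.norm_eq_abs, abs_div, abs_mul,
              abs_of_pos hpos, abs_of_nonneg (by linarith : (0 : ℝ) ≤ j + 1)]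
            simp
        _ = k + √k * ((j + 1) * |s|) := by
            have : (k : ℝ) / √k = √k := Real.div_sqrt
            linear_combination ((j + 1) * |s|) * this
        _ ≤ (j + 1) ^ 2 * 1 + (j + 1) * ((j + 1) * |s|) := by
            gcongr
            nlinarith
        _ ≤ _ := by nlinarith [sq_nonneg (((j : ℝ) + 1) * s)]
  calc _ ≤ a j * ((j + 1) ^ 2 * (2 * s ^ 2 + 1 + |s|)) := by gcongr; exact ha j
    _ = _ := by ring

theorem tendsto_truncatedPhase {a : ℕ → ℝ} (ha : ∀ j, 0 ≤ a j)
    (h2 : Summable fun j : ℕ => ((j : ℝ) + 1) ^ 2 * a j) (s : ℝ) :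
    Tendsto (fun k => truncatedPhase a k s) atTop
      (nhds ((-((∑' j : ℕ, ((j : ℝ) + 1) ^ 2 * a j) / 2) * s ^ 2 : ℝ) : ℂ)) := by
  have e : ((-((∑' j : ℕ, ((j : ℝ) + 1) ^ 2 * a j) / 2) * s ^ 2 : ℝ) : ℂ) =
      ∑' j : ℕ, (a j : ℂ) * (-((((j + 1) * s) ^ 2 / 2 : ℝ) : ℂ)) := by
    rw [neg_mul, div_mul_eq_mul_div, mul_div_assoc, ← tsum_mul_right, ← tsum_neg,
      Complex.ofReal_tsum]
    refine tsum_congr fun j => ?_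
    push_cast; ring
  rw [e]
  refine tendsto_tsum_of_dominated_convergence (h2.mul_right (2 * s ^ 2 + 1 + |s|)) ?_ ?_
  · intro j
    refine Tendsto.const_mul _ ?_
    refine (tendsto_mul_exp_div_sqrt ((j + 1) * s)).congr' ?_
    filter_upwards [eventually_gt_atTop j] with k hk
    rw [if_pos hk]
  · filter_upwards [eventually_gt_atTop 0] with k hk j
    exact norm_truncatedPhase_term_le ha hk s j

theorem truncatedPhase_re_le {a : ℕ → ℝ} (ha : ∀ j, 0 ≤ a j)
    (h2 : Summable fun j : ℕ => ((j : ℝ) + 1) ^ 2 * a j) {k : ℕ} (hk : 0 < k) {s : ℝ}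
    (hs : |s| ≤ Real.pi * √k) :
    (truncatedPhase a k s).re ≤ -(2 / Real.pi ^ 2 * a 0) * s ^ 2 := by
  have hk' : (0 : ℝ) < k := by exact_mod_cast hk
  have hpos : 0 < √(k : ℝ) := Real.sqrt_pos.2 hk'
  have hkk : √(k : ℝ) ^ 2 = k := Real.sq_sqrt hk'.le
  have hsum : Summable fun j : ℕ => (a j : ℂ) * (k * ((if j < k then
      Complex.exp (((j + 1) * s / √k : ℝ) * Complex.I) else 0) - 1
      - ((j + 1) * s / √k : ℝ) * Complex.I)) :=
    Summable.of_norm_bounded (h2.mul_right (2 * s ^ 2 + 1 + |s|))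
      (norm_truncatedPhase_term_le ha hk s)
  have hre : ∀ j, ((a j : ℂ) * (k * ((if j < k then
      Complex.exp (((j + 1) * s / √k : ℝ) * Complex.I) else 0) - 1
      - ((j + 1) * s / √k : ℝ) * Complex.I))).re =
      a j * (k * ((if j < k then Real.cos ((j + 1) * s / √k) else 0) - 1)) := by
    intro j
    rw [Complex.re_ofReal_mul, ← Complex.ofReal_natCast k, Complex.re_ofReal_mul]
    split_ifs with h
    · rw [Complex.sub_re, Complex.sub_re, Complex.exp_ofReal_mul_I_re]; simp
    · simp
  rw [truncatedPhase, Complex.re_tsum hsum]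
  have hsr := Complex.reCLM.summable hsum
  simp only [Complex.reCLM_apply] at hsr
  rw [hsr.tsum_eq_zero_add]
  have hle : ∑' j : ℕ, ((a (j + 1) : ℂ) * (k * ((if j + 1 < k then
      Complex.exp ((((j + 1 : ℕ) + 1) * s / √k : ℝ) * Complex.I) else 0) - 1
      - (((j + 1 : ℕ) + 1) * s / √k : ℝ) * Complex.I))).re ≤ 0 := by
    refine tsum_nonpos fun j => ?_
    rw [hre (j + 1)]
    refine mul_nonpos_of_nonneg_of_nonpos (ha _) (mul_nonpos_of_nonneg_of_nonpos hk'.le ?_)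
    split_ifs
    · linarith [Real.cos_le_one (((j + 1 : ℕ) + 1) * s / √k)]
    · norm_num
  have hx : |s / √k| ≤ Real.pi := by
    rw [abs_div, abs_of_pos hpos, div_le_iff₀ hpos]; exact hs
  have hcos := Real.cos_le_one_sub_mul_cos_sq hx
  have hks : (k : ℝ) * (s / √k) ^ 2 = s ^ 2 := by
    rw [div_pow, hkk]; field_simp
  refine (add_le_of_nonpos_right hle).trans ?_
  rw [hre 0, if_pos hk]
  simp only [Nat.cast_zero, zero_add, one_mul]
  calc _ ≤ a 0 * (k * (-(2 / Real.pi ^ 2 * (s / √k) ^ 2))) := by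
        gcongr
        · exact ha 0
        · linarith
    _ = _ := by rw [← hks]; ring

theorem truncatedPhase_eq {a : ℕ → ℝ} (hs : Summable a)
    (h1 : HasSum (fun j : ℕ => ((j : ℝ) + 1) * a j) 1) (k : ℕ) (s : ℝ) :
    truncatedPhase a k s = ∑ j ∈ Finset.range k,
      ((k * a j : ℝ) : ℂ) * Complex.exp ((j + 1) * (s / √k : ℝ) * Complex.I)
        - k * (s / √k : ℝ) * Complex.I - ((k * ∑' j, a j : ℝ) : ℂ) := by
  have e1 : HasSum (fun j : ℕ => if j < k then ((k * a j : ℝ) : ℂ) *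
      Complex.exp ((j + 1) * (s / √k : ℝ) * Complex.I) else 0)
      (∑ j ∈ Finset.range k, ((k * a j : ℝ) : ℂ) *
        Complex.exp ((j + 1) * (s / √k : ℝ) * Complex.I)) := by
    rw [← Finset.sum_congr rfl fun j hj => if_pos (Finset.mem_range.1 hj)]
    exact hasSum_sum_of_ne_finset_zero fun j hj => if_neg (by simpa using hj)
  have e2 : HasSum (fun j : ℕ => ((((j : ℝ) + 1) * a j : ℝ) : ℂ)) 1 := by
    rw [← Complex.ofReal_one]
    exact Complex.hasSum_ofReal.2 h1
  have e3 : HasSum (fun j : ℕ => (a j : ℂ)) ((∑' j, a j : ℝ) : ℂ) :=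
    Complex.hasSum_ofReal.2 hs.hasSum
  have e := (e1.sub (e2.mul_left (k * (s / √k : ℝ) * Complex.I))).sub (e3.mul_left (k : ℂ))
  rw [truncatedPhase]
  convert e.tsum_eq using 1
  · refine tsum_congr fun j => ?_
    split_ifs
    · push_cast; ring_nf
    · push_cast; ring
  · push_cast; ring

theorem integral_exp_truncatedPhase {a : ℕ → ℝ} (hs : Summable a)
    (h1 : HasSum (fun j : ℕ => ((j : ℝ) + 1) * a j) 1) {k : ℕ} (hk : 0 < k) :
    ∫ s in (-(Real.pi * √k))..(Real.pi * √k), Complex.exp (truncatedPhase a k s) =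
      ((2 * Real.pi * (√k * Real.exp (-(k * ∑' j, a j)) * ∑ l ∈ bellTuples k, ∏ i : Fin k,
        (k * a i) ^ l i / (Nat.factorial (l i) : ℝ)) : ℝ) : ℂ) := by
  have hpos : 0 < √(k : ℝ) := Real.sqrt_pos.2 (by exact_mod_cast hk)
  have h := intervalIntegral.smul_integral_comp_mul_left (a := -Real.pi) (b := Real.pi)
    (fun s => Complex.exp (truncatedPhase a k s)) √(k : ℝ)
  have e : √(k : ℝ) * -Real.pi = -(Real.pi * √k) := by ring
  rw [e, mul_comm √(k : ℝ)] at h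
  rw [← h]
  have e' : ∀ θ : ℝ, Complex.exp (truncatedPhase a k (√k * θ)) =
      Complex.exp (((-(k * ∑' j, a j) : ℝ) : ℂ)) *
      Complex.exp (∑ j ∈ Finset.range k, ((k * a j : ℝ) : ℂ) *
        Complex.exp ((j + 1) * θ * Complex.I) - k * θ * Complex.I) := by
    intro θ
    rw [truncatedPhase_eq hs h1, mul_div_cancel_left₀ θ hpos.ne', ← Complex.exp_add]
    congr 1
    push_cast; ring
  simp_rw [e']
  rw [intervalIntegral.integral_const_mul, integral_exp_trigPoly k fun j => k * a j,
    Complex.real_smul]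
  push_cast; ring

theorem tendsto_sqrt_mul_bellSum {a : ℕ → ℝ} (ha : ∀ j, 0 ≤ a j) (ha0 : 0 < a 0)
    (h1 : HasSum (fun j : ℕ => ((j : ℝ) + 1) * a j) 1)
    (h2 : Summable fun j : ℕ => ((j : ℝ) + 1) ^ 2 * a j) :
    Tendsto (fun k : ℕ => 2 * Real.pi * (√k * Real.exp (-(k * ∑' j, a j)) *
      ∑ l ∈ bellTuples k, ∏ i : Fin k, (k * a i) ^ l i / (Nat.factorial (l i) : ℝ)))
      atTop (nhds √(2 * Real.pi / ∑' j : ℕ, ((j : ℝ) + 1) ^ 2 * a j)) := by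
  have hs : Summable a := by
    refine h1.summable.of_nonneg_of_le ha fun j => ?_
    nlinarith [mul_nonneg (Nat.cast_nonneg (α := ℝ) j) (ha j)]
  set v := ∑' j : ℕ, ((j : ℝ) + 1) ^ 2 * a j with hv
  have hpi := Real.pi_pos
  have hlim : ∫ s : ℝ, Complex.exp ((-(v / 2) * s ^ 2 : ℝ) : ℂ) = (√(2 * Real.pi / v) : ℝ) := by
    simp_rw [← Complex.ofReal_exp]
    rw [integral_complex_ofReal, integral_gaussian]
    congr 2
    field_simp
  have key : Tendsto (fun k : ℕ => ∫ s, (Set.Ioc (-(Real.pi * √k)) (Real.pi * √k)).indicator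
      (fun s => Complex.exp (truncatedPhase a k s)) s) atTop
      (nhds ((√(2 * Real.pi / v) : ℝ) : ℂ)) := by
    rw [← hlim]
    refine tendsto_integral_of_dominated_convergence
      (fun s => Real.exp (-(2 / Real.pi ^ 2 * a 0) * s ^ 2)) ?_
      (integrable_exp_neg_mul_sq (by positivity)) ?_ (ae_of_all _ fun s => ?_)
    · intro k
      rcases Nat.eq_zero_or_pos k with rfl | hk
      · simpa using aestronglyMeasurable_const
      · have hc : Continuous fun s => Complex.exp (truncatedPhase a k s) := by
          simp_rw [truncatedPhase_eq hs h1]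
          fun_prop
        exact hc.aestronglyMeasurable.indicator measurableSet_Ioc
    · refine fun k => ae_of_all _ fun s => ?_
      rw [Set.indicator_apply]
      split_ifs with h
      · rcases Nat.eq_zero_or_pos k with rfl | hk
        · simp at h
        · rw [Complex.norm_exp]
          exact Real.exp_le_exp.2 (truncatedPhase_re_le ha h2 hk (abs_le.2 ⟨h.1.le, h.2⟩))
      · simpa using (Real.exp_pos _).le
    · refine ((Complex.continuous_exp.tendsto _).comp
        (tendsto_truncatedPhase ha h2 s)).congr' ?_
      have hsq : Tendsto (fun k : ℕ => Real.pi * √(k : ℝ)) atTop atTop :=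
        (Real.tendsto_sqrt_atTop.comp tendsto_natCast_atTop_atTop).const_mul_atTop hpi
      filter_upwards [hsq.eventually_gt_atTop |s|] with k hk
      have := abs_lt.1 hk
      rw [Set.indicator_of_mem (Set.mem_Ioc.2 ⟨this.1, this.2.le⟩)]
      rfl
  rw [← tendsto_ofReal_iff]
  refine key.congr' ?_
  filter_upwards [eventually_gt_atTop 0] with k hk
  rw [integral_indicator measurableSet_Ioc, ← integral_exp_truncatedPhase hs h1 hk,
    intervalIntegral.integral_of_le]
  have : 0 ≤ Real.pi * √(k : ℝ) := by positivity
  linarith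

theorem summable_sq_mul_weight {V : ℕ → ℝ} (hVpos : ∀ i : ℕ, 1 ≤ i → 0 ≤ V i) {u0 : ℝ≥0∞}
    (hH : HFinite V u0) {u : ℝ} (hu : 0 < u) (huu0 : ENNReal.ofReal u < u0) :
    Summable fun j : ℕ =>
      ((j : ℝ) + 1) ^ 2 * (V (j + 1) * u ^ (j + 1) / (Nat.factorial (j + 1) : ℝ)) := by
  obtain ⟨w, hw, hw'⟩ := ENNReal.lt_iff_exists_nnreal_btwn.1 huu0
  have huw : u < w := (ENNReal.ofReal_lt_coe_iff hu.le).1 hw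
  have hw0 : (0 : ℝ) < w := hu.trans huw
  have hsum := hH w hw0.le (by simpa using hw')
  obtain ⟨C, hC⟩ := hsum.tendsto_atTop_zero.bddAbove_range
  have hr : ‖u / w‖ < 1 := by
    rw [Real.norm_of_nonneg (by positivity)]; exact (div_lt_one hw0).2 huw
  have hgeom := (summable_nat_add_iff 1).2
    ((summable_pow_mul_geometric_of_norm_lt_one 2 hr).mul_left C)
  have ht : ∀ j : ℕ, 0 ≤ V (j + 1) := fun j => hVpos _ (by omega)
  refine hgeom.of_nonneg_of_le (fun j => ?_) (fun j => ?_)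
  · have := ht j
    positivity
  · have hc := hC ⟨j, rfl⟩
    simp only at hc
    have e : V (j + 1) * u ^ (j + 1) / (Nat.factorial (j + 1) : ℝ) =
        V (j + 1) * (w : ℝ) ^ (j + 1) / (Nat.factorial (j + 1) : ℝ) * (u / w) ^ (j + 1) := by
      rw [div_pow]; field_simp
    rw [e]
    calc _ ≤ ((j : ℝ) + 1) ^ 2 * (C * (u / w) ^ (j + 1)) := by gcongr
      _ = _ := by push_cast; ring

theorem weightedBell_mul_eq (V : ℕ → ℝ) (k : ℕ) (χ u : ℝ) :
    weightedBell V k (χ * k) * u ^ k = (Nat.factorial k : ℝ) * ∑ l ∈ bellTuples k, ∏ i : Fin k,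
      (k * (χ * (V (i + 1) * u ^ (i.1 + 1) / (Nat.factorial (i + 1) : ℝ)))) ^ l i /
        (Nat.factorial (l i) : ℝ) := by
  rw [weightedBell, mul_assoc, Finset.sum_mul]
  congr 1
  refine Finset.sum_congr rfl fun l hl => ?_
  have e : u ^ k = ∏ i : Fin k, (u ^ (i.1 + 1)) ^ l i := by
    simp_rw [← pow_mul]
    rw [Finset.prod_pow_eq_pow_sum, mem_bellTuples.1 hl]
  rw [e, ← Finset.prod_mul_distrib]
  refine Finset.prod_congr rfl fun i _ => ?_
  rw [← div_div, ← div_pow, div_mul_eq_mul_div, ← mul_pow]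
  congr 2
  ring

/-- Theorem 1.1, part A, relation (1.10): sharp asymptotics of `M_k(χ k)`. -/
theorem stmt3 (V : ℕ → ℝ) (hVpos : ∀ i : ℕ, 1 ≤ i → 0 ≤ V i) (hV1 : 0 < V 1)
    (u0 : ℝ≥0∞) (hu0 : 0 < u0) (hH : HFinite V u0)
    (χ : ℝ) (hχ : 0 < χ)
    (u : ℝ) (hu : 0 < u) (huu0 : ENNReal.ofReal u < u0)
    (hLambert : u * weightEGFDeriv V u = 1 / χ) :
    Tendsto (fun k : ℕ =>
        weightedBell V k (χ * k) * Real.sqrt (1 + χ * u ^ 2 * weightEGFDeriv2 V u) /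
          (χ * k * weightEGFDeriv V u *
            Real.exp ((weightEGF V u - 1) / (u * weightEGFDeriv V u) - 1)) ^ k)
      atTop (nhds 1) := by
  set b : ℕ → ℝ := fun j => V (j + 1) * u ^ (j + 1) / (Nat.factorial (j + 1) : ℝ) with hb
  set a : ℕ → ℝ := fun j => χ * b j with haDef
  have hbn : ∀ j, 0 ≤ b j := fun j => by
    have := hVpos (j + 1) (by omega)
    simp only [hb]; positivity
  have ha : ∀ j, 0 ≤ a j := fun j => mul_nonneg hχ.le (hbn j)
  have ha0 : 0 < a 0 := by simp only [haDef, hb]; simp; positivity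
  have h2b : Summable fun j : ℕ => ((j : ℝ) + 1) ^ 2 * b j :=
    summable_sq_mul_weight hVpos hH hu huu0
  have h2 : Summable fun j : ℕ => ((j : ℝ) + 1) ^ 2 * a j :=
    (h2b.mul_left χ).congr fun j => by simp only [haDef]; ring
  have hs1 : Summable fun j : ℕ => ((j : ℝ) + 1) * a j := by
    refine h2.of_nonneg_of_le (fun j => mul_nonneg (by positivity) (ha j)) fun j => ?_
    have : (0 : ℝ) ≤ j := Nat.cast_nonneg j
    exact mul_le_mul_of_nonneg_right (by nlinarith) (ha j)
  have hderiv : ∑' j : ℕ, ((j : ℝ) + 1) * a j = 1 := by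
    have h : χ * u * weightEGFDeriv V u = 1 := by
      rw [mul_assoc, hLambert]; field_simp
    refine Eq.trans ?_ h
    rw [weightEGFDeriv, ← tsum_mul_left]
    refine tsum_congr fun j => ?_
    simp only [haDef, hb, Nat.factorial_succ]
    push_cast
    have : (Nat.factorial j : ℝ) ≠ 0 := by positivity
    have : (j : ℝ) + 1 ≠ 0 := by positivity
    field_simp
    ring
  have h1 : HasSum (fun j : ℕ => ((j : ℝ) + 1) * a j) 1 := by
    simpa only [hderiv] using hs1.hasSum
  have hvar : ∑' j : ℕ, ((j : ℝ) + 1) ^ 2 * a j = 1 + χ * u ^ 2 * weightEGFDeriv2 V u := by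
    have hsub : Summable fun j : ℕ => (j : ℝ) * ((j + 1) * a j) :=
      (h2.sub hs1).congr fun j => by ring
    have e : ∀ j : ℕ, ((j : ℝ) + 1) ^ 2 * a j = (j + 1) * a j + j * ((j + 1) * a j) :=
      fun j => by ring
    simp_rw [e]
    rw [hs1.tsum_add hsub, hderiv, hsub.tsum_eq_zero_add, weightEGFDeriv2, ← tsum_mul_left]
    simp only [Nat.cast_zero, zero_mul, zero_add]
    congr 1
    refine tsum_congr fun j => ?_
    simp only [haDef, hb, Nat.factorial_succ]
    push_cast
    have : (Nat.factorial j : ℝ) ≠ 0 := by positivity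
    have : (j : ℝ) + 1 ≠ 0 := by positivity
    have : (j : ℝ) + 1 + 1 ≠ 0 := by positivity
    field_simp
    ring
  have hEGF : (weightEGF V u - 1) / (u * weightEGFDeriv V u) = ∑' j, a j := by
    rw [hLambert, weightEGF, haDef, tsum_mul_left]
    simp [hb, mul_comm]
  have hD : χ * weightEGFDeriv V u = u⁻¹ := by
    field_simp at hLambert ⊢
    linarith
  set v := ∑' j : ℕ, ((j : ℝ) + 1) ^ 2 * a j with hv
  have hvpos : 0 < v :=
    h2.tsum_pos (fun j => mul_nonneg (by positivity) (ha j)) 0 (by simpa using ha0)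
  have hlim := ((Stirling.tendsto_stirlingSeq_sqrt_pi.mul
    (tendsto_sqrt_mul_bellSum ha ha0 h1 h2)).mul_const (√v * √2 / (2 * Real.pi)))
  have hpi := Real.pi_pos
  have hone : √Real.pi * √(2 * Real.pi / v) * (√v * √2 / (2 * Real.pi)) = 1 := by
    rw [Real.sqrt_div (by positivity), Real.sqrt_mul (by norm_num)]
    have : √v ≠ 0 := by positivity
    field_simp
    rw [Real.sq_sqrt hpi.le, Real.sq_sqrt (by norm_num)]
    ring
  rw [hone] at hlim
  refine hlim.congr' ?_
  filter_upwards [eventually_gt_atTop 0] with k hk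
  have hk' : (0 : ℝ) < k := by exact_mod_cast hk
  have hbell : weightedBell V k (χ * k) * u ^ k = (Nat.factorial k : ℝ) *
      ∑ l ∈ bellTuples k, ∏ i : Fin k, (k * a i) ^ l i / (Nat.factorial (l i) : ℝ) :=
    weightedBell_mul_eq V k χ u
  have hbase : χ * k * weightEGFDeriv V u = k / u := by
    rw [mul_right_comm, hD]; field_simp
  generalize ∑ l ∈ bellTuples k, ∏ i : Fin k, (k * a i) ^ l i / (Nat.factorial (l i) : ℝ) = W
    at hbell ⊢
  rw [← hvar, hEGF, hbase, eq_div_of_mul_eq (by positivity) hbell, Stirling.stirlingSeq,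
    Real.exp_sub, mul_pow, div_pow, div_pow, div_pow, ← Real.exp_nat_mul (∑' j, a j) k,
    Real.exp_neg, Real.sqrt_mul (by norm_num)]
  have : √(k : ℝ) ≠ 0 := by positivity
  field_simp

end
end

section
/- (Lemma 2.1, asymptotic normality.) Assume V_i ≥ 0 for all i ≥ 1 and H(u) < ∞ for all u ∈ [0, u_0). For x > 0 and u ∈ (0, u_0), let Z^{(x,u)} be the ℕ-valued random variable with P(Z^{(x,u)} = j) = M_j(x)·u^j/( j!·exp( x·(H(u) − 1) ) ), and write σ(x,u) = √Var(Z^{(x,u)}). Let (x_N)_{N≥1} and (u_N)_{N≥1} be sequences with x_N → ∞, u_N ∈ (0, u_0), u_N → û for some û ∈ [0, u_0), and Var(Z^{(x_N,u_N)}) → ∞. Then for every t ∈ ℝ, E exp( i·t·( Z^{(x_N,u_N)} − E Z^{(x_N,u_N)} )/σ(x_N,u_N) ) → exp( −t²/2 ) as N → ∞; that is, the normalized variables converge in distribution to the standard normal law. -/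
open scoped BigOperators ENNReal
open Filter MeasureTheory

noncomputable section

theorem summable_and_hasSum_pi_prod {R : Type*} [NormedCommRing R] [CompleteSpace R]
    (n : ℕ) (f : Fin n → ℕ → R)
    (hf : ∀ i, Summable fun m => ‖f i m‖) :
    (Summable fun l : Fin n → ℕ => ‖∏ i, f i (l i)‖) ∧
      HasSum (fun l : Fin n → ℕ => ∏ i, f i (l i)) (∏ i, ∑' m, f i m) := by
  induction n with
  | zero => exact ⟨(hasSum_fintype _).summable, by simp⟩
  | succ n ih =>
    obtain ⟨hs, hh⟩ := ih (fun i => f i.succ) (fun i => hf i.succ)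
    have h0 := hf 0
    have hS := h0.mul_norm hs
    have hS' := summable_mul_of_summable_norm h0 hs
    have hP := h0.of_norm.hasSum.mul hh hS'
    rw [← (Fin.consEquiv fun _ => ℕ).summable_iff, ← (Fin.consEquiv fun _ => ℕ).hasSum_iff,
      Fin.prod_univ_succ]
    have he : (fun l : Fin (n + 1) → ℕ => ∏ i, f i (l i)) ∘ (Fin.consEquiv fun _ => ℕ)
        = fun p : ℕ × (Fin n → ℕ) => f 0 p.1 * ∏ i : Fin n, f i.succ (p.2 i) := by
      ext p
      simp [Fin.consEquiv, Fin.prod_univ_succ]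
    refine ⟨?_, ?_⟩
    · convert hS using 2 with p
      exact congrArg norm (congrFun he p)
    · rwa [he]

/-- Tuples in `n` variables of weight `k`, part sizes being `1, ..., n`. -/
def weightTuples (n k : ℕ) : Finset (Fin n → ℕ) :=
  (Fintype.piFinset fun _ => Finset.range (k + 1)).filter
    (fun l => ∑ i, (i.1 + 1) * l i = k)

theorem mem_weightTuples {n k : ℕ} {l : Fin n → ℕ} :
    l ∈ weightTuples n k ↔ ∑ i, (i.1 + 1) * l i = k := by
  simp only [weightTuples, Finset.mem_filter, Fintype.mem_piFinset, Finset.mem_range,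
    and_iff_right_iff_imp]
  rintro h i
  have := Finset.single_le_sum (f := fun i : Fin n => (i.1 + 1) * l i) (fun _ _ => Nat.zero_le _)
    (Finset.mem_univ i)
  nlinarith

/-- Coefficients of `exp (∑ i < n, c i * z ^ (i + 1))`. -/
def expCoeff (c : ℕ → ℝ) (n k : ℕ) : ℝ :=
  ∑ l ∈ weightTuples n k, ∏ i : Fin n, c i ^ l i / (Nat.factorial (l i) : ℝ)

theorem expCoeff_nonneg {c : ℕ → ℝ} (hc : ∀ i, 0 ≤ c i) (n k : ℕ) : 0 ≤ expCoeff c n k :=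
  Finset.sum_nonneg fun _ _ => Finset.prod_nonneg fun i _ =>
    div_nonneg (pow_nonneg (hc i) _) (Nat.cast_nonneg _)

theorem hasSum_expCoeff (c : ℕ → ℝ) (n : ℕ) (z : ℂ) :
    HasSum (fun k => (expCoeff c n k : ℂ) * z ^ k)
      (Complex.exp (∑ i ∈ Finset.range n, (c i : ℂ) * z ^ (i + 1))) := by
  have hexp : ∀ w : ℂ, HasSum (fun m : ℕ => w ^ m / (m.factorial : ℂ)) (Complex.exp w) := by
    intro w
    rw [Complex.exp_eq_exp_ℂ]
    exact NormedSpace.expSeries_div_hasSum_exp w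
  have h := (summable_and_hasSum_pi_prod n
    (fun i m => ((c i : ℂ) * z ^ (i.1 + 1)) ^ m / (m.factorial : ℂ))
    (fun i => NormedSpace.norm_expSeries_div_summable _)).2.tsum_fiberwise
      (fun l : Fin n → ℕ => ∑ i, (i.1 + 1) * l i)
  simp only [(hexp _).tsum_eq, ← Complex.exp_sum] at h
  rw [Fin.sum_univ_eq_sum_range (fun i => (c i : ℂ) * z ^ (i + 1)) n] at h
  suffices hfun : ∀ k, (expCoeff c n k : ℂ) * z ^ k =
      ∑' b : ((fun l : Fin n → ℕ => ∑ i, (i.1 + 1) * l i) ⁻¹' {k} : Set (Fin n → ℕ)),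
        ∏ i : Fin n, ((c i : ℂ) * z ^ (i.1 + 1)) ^ b.1 i / ((b.1 i).factorial : ℂ) by
    simp_rw [hfun]
    exact h
  intro k
  have hset : (fun l : Fin n → ℕ => ∑ i, (i.1 + 1) * l i) ⁻¹' {k} = ↑(weightTuples n k) := by
    ext l
    simp [mem_weightTuples]
  rw [hset, Finset.tsum_subtype' (weightTuples n k)
    (fun l => ∏ i : Fin n, ((c i : ℂ) * z ^ (i.1 + 1)) ^ l i / ((l i).factorial : ℂ)), expCoeff]
  push_cast
  rw [Finset.sum_mul]
  refine Finset.sum_congr rfl fun l hl => ?_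
  rw [← mem_weightTuples.1 hl, ← Finset.prod_pow_eq_pow_sum, ← Finset.prod_mul_distrib]
  refine Finset.prod_congr rfl fun i _ => ?_
  rw [mul_pow, pow_mul]
  ring

theorem sum_filter_last_eq_zero (c : ℕ → ℝ) (n k : ℕ) :
    ∑ l ∈ (weightTuples (n + 1) k).filter (fun l => l (Fin.last n) = 0),
      ∏ i : Fin (n + 1), c i ^ l i / (Nat.factorial (l i) : ℝ) = expCoeff c n k := by
  symm
  refine Finset.sum_bij' (fun l _ => Fin.snoc (α := fun _ => ℕ) l 0)
    (fun l _ => Fin.init (α := fun _ => ℕ) l) ?_ ?_ ?_ ?_ ?_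
  · intro l hl
    simpa [mem_weightTuples, Fin.sum_univ_castSucc] using mem_weightTuples.1 hl
  · intro l hl
    simp only [Finset.mem_filter, mem_weightTuples, Fin.sum_univ_castSucc] at hl
    rw [mem_weightTuples]
    simpa [hl.2, Fin.init] using hl.1
  · intro l _
    simp
  · intro l hl
    have := (Finset.mem_filter.1 hl).2
    rw [← this]
    simp
  · intro l _
    simp [Fin.prod_univ_castSucc]

theorem expCoeff_le_succ {c : ℕ → ℝ} (hc : ∀ i, 0 ≤ c i) (n k : ℕ) :
    expCoeff c n k ≤ expCoeff c (n + 1) k := by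
  rw [← sum_filter_last_eq_zero]
  exact Finset.sum_le_sum_of_subset_of_nonneg (Finset.filter_subset _ _) fun _ _ _ =>
    Finset.prod_nonneg fun i _ => div_nonneg (pow_nonneg (hc i) _) (Nat.cast_nonneg _)

theorem expCoeff_eq_self {c : ℕ → ℝ} {n k : ℕ} (h : k ≤ n) :
    expCoeff c n k = expCoeff c k k := by
  induction n, h using Nat.le_induction with
  | base => rfl
  | succ n hn ih =>
    rw [← ih, ← sum_filter_last_eq_zero c n, Finset.filter_true_of_mem, expCoeff]
    intro l hl
    have h1 := mem_weightTuples.1 hl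
    rw [Fin.sum_univ_castSucc, Fin.val_last] at h1
    by_contra h0
    have : 1 ≤ l (Fin.last n) := Nat.one_le_iff_ne_zero.2 h0
    nlinarith [Nat.zero_le (∑ i : Fin n, (i.castSucc.1 + 1) * l i.castSucc)]

theorem expCoeff_le_self {c : ℕ → ℝ} (hc : ∀ i, 0 ≤ c i) (n k : ℕ) :
    expCoeff c n k ≤ expCoeff c k k := by
  rw [← expCoeff_eq_self (le_max_right n k)]
  exact monotone_nat_of_le_succ (f := fun n => expCoeff c n k)
    (fun n => expCoeff_le_succ hc n k) (le_max_left n k)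

theorem summable_expCoeff {c : ℕ → ℝ} (hc : ∀ i, 0 ≤ c i) {r : ℝ} (hr : 0 ≤ r)
    (hs : Summable fun i => c i * r ^ (i + 1)) :
    Summable fun k => expCoeff c k k * r ^ k := by
  refine summable_of_sum_range_le (c := Real.exp (∑' i, c i * r ^ (i + 1)))
    (fun k => mul_nonneg (expCoeff_nonneg hc k k) (pow_nonneg hr k)) fun n => ?_
  have h : HasSum (fun k => expCoeff c n k * r ^ k)
      (Real.exp (∑ i ∈ Finset.range n, c i * r ^ (i + 1))) := by
    have := hasSum_expCoeff c n (r : ℂ)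
    exact_mod_cast this
  calc ∑ k ∈ Finset.range n, expCoeff c k k * r ^ k
      = ∑ k ∈ Finset.range n, expCoeff c n k * r ^ k :=
        Finset.sum_congr rfl fun k hk => by rw [expCoeff_eq_self (Finset.mem_range.1 hk).le]
    _ ≤ Real.exp (∑ i ∈ Finset.range n, c i * r ^ (i + 1)) :=
        sum_le_hasSum _ (fun k _ => mul_nonneg (expCoeff_nonneg hc n k) (pow_nonneg hr k)) h
    _ ≤ _ := Real.exp_le_exp.2 <|
        hs.sum_le_tsum _ fun i _ => mul_nonneg (hc i) (pow_nonneg hr _)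

/-- The exponential formula: generating function of the coefficients `expCoeff c k k`. -/
theorem hasSum_expCoeff_self {c : ℕ → ℝ} (hc : ∀ i, 0 ≤ c i) {z : ℂ}
    (hs : Summable fun i => c i * ‖z‖ ^ (i + 1)) :
    HasSum (fun k => (expCoeff c k k : ℂ) * z ^ k)
      (Complex.exp (∑' i, (c i : ℂ) * z ^ (i + 1))) := by
  have hS := summable_expCoeff hc (norm_nonneg z) hs
  have hnorm : ∀ n k, ‖(expCoeff c n k : ℂ) * z ^ k‖ = expCoeff c n k * ‖z‖ ^ k := fun n k => by
    rw [norm_mul, norm_pow, Complex.norm_real, Real.norm_of_nonneg (expCoeff_nonneg hc n k)]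
  have hlim := tendsto_tsum_of_dominated_convergence (𝓕 := atTop)
    (f := fun n k => (expCoeff c n k : ℂ) * z ^ k)
    (g := fun k => (expCoeff c k k : ℂ) * z ^ k) hS
    (fun k => tendsto_atTop_of_eventually_const (i₀ := k) fun n hn => by
      rw [expCoeff_eq_self hn])
    (Eventually.of_forall fun n k => by
      rw [hnorm]
      exact mul_le_mul_of_nonneg_right (expCoeff_le_self hc n k) (by positivity))
  have hs' : Summable fun i => (c i : ℂ) * z ^ (i + 1) := by
    refine Summable.of_norm (hs.congr fun i => ?_)
    rw [norm_mul, norm_pow, Complex.norm_real, Real.norm_of_nonneg (hc i)]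
  have hlim' := (Complex.continuous_exp.tendsto _).comp hs'.hasSum.tendsto_sum_nat
  have : Summable fun k => (expCoeff c k k : ℂ) * z ^ k :=
    Summable.of_norm (hS.congr fun k => (hnorm k k).symm)
  rw [← tendsto_nhds_unique hlim (hlim'.congr fun n => (hasSum_expCoeff c n z).tsum_eq.symm)]
  exact this.hasSum

theorem weightedBell_mul_pow_div_factorial (V : ℕ → ℝ) (x u : ℝ) (k : ℕ) :
    weightedBell V k x * u ^ k / (Nat.factorial k : ℝ) =
      expCoeff (fun i => x * V (i + 1) * u ^ (i + 1) / (Nat.factorial (i + 1) : ℝ)) k k := by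
  have hk : (Nat.factorial k : ℝ) ≠ 0 := by positivity
  rw [weightedBell, mul_assoc, mul_div_cancel_left₀ _ hk, expCoeff, Finset.sum_mul]
  refine Finset.sum_congr rfl fun l hl => ?_
  have hu : u ^ k = ∏ i : Fin k, u ^ ((i.1 + 1) * l i) := by
    rw [Finset.prod_pow_eq_pow_sum, mem_weightTuples.1 hl]
  rw [hu, ← Finset.prod_mul_distrib]
  refine Finset.prod_congr rfl fun i _ => ?_
  rw [div_pow, mul_pow (x * V (i + 1)), pow_mul]
  field_simp

theorem integrable_iff_summable_of_singleton {E : Type*} [NormedAddCommGroup E]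
    {ν : Measure ℕ} {p : ℕ → ℝ} (hp : ∀ j, 0 ≤ p j)
    (hν : ∀ j, ν {j} = ENNReal.ofReal (p j)) (f : ℕ → E) :
    Integrable f ν ↔ Summable fun j => p j * ‖f j‖ := by
  have h0 : ∀ j, 0 ≤ p j * ‖f j‖ := fun j => mul_nonneg (hp j) (norm_nonneg _)
  have hl : ∫⁻ j, ENNReal.ofReal ‖f j‖ ∂ν = ∑' j, ENNReal.ofReal (p j * ‖f j‖) := by
    rw [lintegral_countable']
    exact tsum_congr fun j => by rw [hν, mul_comm, ← ENNReal.ofReal_mul (hp j)]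
  have hm : AEStronglyMeasurable f ν := StronglyMeasurable.of_discrete.aestronglyMeasurable
  rw [Integrable, hasFiniteIntegral_iff_norm, hl, and_iff_right hm]
  refine ⟨fun h => ?_, fun h => h.tsum_ofReal_lt_top⟩
  have := ENNReal.summable_toReal h.ne
  simpa only [ENNReal.toReal_ofReal (h0 _)] using this

theorem integral_eq_tsum_of_singleton {E : Type*} [NormedAddCommGroup E] [NormedSpace ℝ E]
    [CompleteSpace E] {ν : Measure ℕ} {p : ℕ → ℝ} (hp : ∀ j, 0 ≤ p j)
    (hν : ∀ j, ν {j} = ENNReal.ofReal (p j)) {f : ℕ → E}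
    (hf : Summable fun j => p j * ‖f j‖) :
    ∫ j, f j ∂ν = ∑' j, p j • f j := by
  rw [integral_countable ((integrable_iff_summable_of_singleton hp hν f).2 hf)]
  exact tsum_congr fun j => by rw [Measure.real, hν, ENNReal.toReal_ofReal (hp j)]

/-- The measure on `ℕ` with mass `c i` at `i`. -/
def massMeasure (c : ℕ → ℝ) : Measure ℕ :=
  Measure.sum fun i => ENNReal.ofReal (c i) • Measure.dirac i

theorem massMeasure_singleton (c : ℕ → ℝ) (j : ℕ) :
    massMeasure c {j} = ENNReal.ofReal (c j) := by
  rw [massMeasure, Measure.sum_apply _ (measurableSet_singleton j), tsum_eq_single j]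
  · simp
  · intro i hi
    simp [hi]

section ExpMoments

variable {c : ℕ → ℝ} {ρ : ℝ}

theorem summable_mul_exp_of_exp_le (hc : ∀ i, 0 ≤ c i) (hs : Summable fun i => c i * ρ ^ (i + 1))
    {s : ℝ} (h : Real.exp s ≤ ρ) : Summable fun i => c i * Real.exp s ^ (i + 1) :=
  hs.of_nonneg_of_le (fun i => mul_nonneg (hc i) (by positivity)) fun i =>
    mul_le_mul_of_nonneg_left (pow_le_pow_left₀ (Real.exp_pos s).le h _) (hc i)

theorem exp_mul_natCast_eq_pow (s : ℝ) (n : ℕ) :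
    Real.exp (s * (n : ℝ)) = Real.exp s ^ n := by
  rw [← Real.exp_nat_mul, mul_comm]

theorem norm_exp_ofReal (s : ℝ) : ‖((Real.exp s : ℝ) : ℂ)‖ = Real.exp s := by
  rw [Complex.norm_real, Real.norm_of_nonneg (Real.exp_pos s).le]

theorem exp_mul_add_one_eq_pow (s : ℝ) (i : ℕ) :
    Real.exp (s * ((i : ℝ) + 1)) = Real.exp s ^ (i + 1) := by
  rw [← Real.exp_nat_mul]
  push_cast
  ring_nf

theorem eventually_exp_le (hρ : 1 < ρ) : ∀ᶠ s in nhds (0 : ℝ), Real.exp s ≤ ρ := by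
  have := Real.continuous_exp.tendsto 0
  rw [Real.exp_zero] at this
  exact (this.eventually_lt_const hρ).mono fun _ h => h.le

theorem zero_mem_interior_integrableExpSet_massMeasure (hc : ∀ i, 0 ≤ c i) (hρ : 1 < ρ)
    (hs : Summable fun i => c i * ρ ^ (i + 1)) :
    0 ∈ interior (ProbabilityTheory.integrableExpSet (fun i : ℕ => (i : ℝ) + 1)
      (massMeasure c)) := by
  rw [mem_interior_iff_mem_nhds]
  filter_upwards [eventually_exp_le hρ] with s h
  refine (integrable_iff_summable_of_singleton hc (massMeasure_singleton c) _).2 ?_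
  simpa [exp_mul_add_one_eq_pow] using summable_mul_exp_of_exp_le hc hs h

theorem summable_mul_pow_moment (hc : ∀ i, 0 ≤ c i) (hρ : 1 < ρ)
    (hs : Summable fun i => c i * ρ ^ (i + 1)) (n : ℕ) :
    Summable fun i => c i * ((i : ℝ) + 1) ^ n := by
  have := ProbabilityTheory.integrable_pow_of_mem_interior_integrableExpSet
    (zero_mem_interior_integrableExpSet_massMeasure hc hρ hs) n
  rw [integrable_iff_summable_of_singleton hc (massMeasure_singleton c)] at this
  refine this.congr fun i => ?_
  rw [Real.norm_of_nonneg (by positivity)]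

theorem mgf_massMeasure (hc : ∀ i, 0 ≤ c i) (hs : Summable fun i => c i * ρ ^ (i + 1))
    {s : ℝ} (h : Real.exp s ≤ ρ) :
    ProbabilityTheory.mgf (fun i : ℕ => (i : ℝ) + 1) (massMeasure c) s =
      ∑' i, c i * Real.exp s ^ (i + 1) := by
  rw [ProbabilityTheory.mgf, integral_eq_tsum_of_singleton hc (massMeasure_singleton c)]
  · simp [exp_mul_add_one_eq_pow]
  · simpa [exp_mul_add_one_eq_pow] using summable_mul_exp_of_exp_le hc hs h

theorem iteratedDeriv_mgf_massMeasure (hc : ∀ i, 0 ≤ c i) (hρ : 1 < ρ)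
    (hs : Summable fun i => c i * ρ ^ (i + 1)) (n : ℕ) :
    iteratedDeriv n (ProbabilityTheory.mgf (fun i : ℕ => (i : ℝ) + 1) (massMeasure c)) 0 =
      ∑' i, c i * ((i : ℝ) + 1) ^ n := by
  rw [ProbabilityTheory.iteratedDeriv_mgf_zero
    (zero_mem_interior_integrableExpSet_massMeasure hc hρ hs)]
  rw [integral_eq_tsum_of_singleton hc (massMeasure_singleton c)]
  · simp
  · refine (summable_mul_pow_moment hc hρ hs n).congr fun i => ?_
    rw [Pi.pow_apply, Real.norm_of_nonneg (by positivity)]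

end ExpMoments

/-- `Z` has the compound Poisson law in which jumps of size `i + 1` occur at rate `c i`. -/
structure IsCompoundPoisson {Ω : Type*} [MeasurableSpace Ω] (μ : Measure Ω) (Z : Ω → ℕ)
    (c : ℕ → ℝ) : Prop where
  measurable : Measurable Z
  nonneg : ∀ i, 0 ≤ c i
  law : ∀ j, μ {ω | Z ω = j} = ENNReal.ofReal (expCoeff c j j * Real.exp (-∑' i, c i))

namespace IsCompoundPoisson

variable {Ω : Type*} [MeasurableSpace Ω] {μ : Measure Ω} {Z : Ω → ℕ} {c : ℕ → ℝ}

theorem map_singleton (h : IsCompoundPoisson μ Z c) (j : ℕ) :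
    μ.map Z {j} = ENNReal.ofReal (expCoeff c j j * Real.exp (-∑' i, c i)) := by
  rw [Measure.map_apply h.measurable (measurableSet_singleton j), ← h.law]
  rfl

theorem mass_nonneg (h : IsCompoundPoisson μ Z c) (j : ℕ) :
    0 ≤ expCoeff c j j * Real.exp (-∑' i, c i) :=
  mul_nonneg (expCoeff_nonneg h.nonneg j j) (Real.exp_pos _).le

theorem summable_mass_mul_norm_pow (h : IsCompoundPoisson μ Z c) {z : ℂ}
    (hs : Summable fun i => c i * ‖z‖ ^ (i + 1)) :
    Summable fun j => expCoeff c j j * Real.exp (-∑' i, c i) * ‖z ^ j‖ := by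
  refine ((summable_expCoeff h.nonneg (norm_nonneg z) hs).mul_right
    (Real.exp (-∑' i, c i))).congr fun j => ?_
  rw [norm_pow]
  ring

theorem integrable_pow (h : IsCompoundPoisson μ Z c) {z : ℂ}
    (hs : Summable fun i => c i * ‖z‖ ^ (i + 1)) :
    Integrable (fun ω => z ^ Z ω) μ := by
  have := (integrable_iff_summable_of_singleton h.mass_nonneg h.map_singleton
    (fun j => z ^ j)).2 (h.summable_mass_mul_norm_pow hs)
  exact this.comp_measurable h.measurable

theorem integral_pow (h : IsCompoundPoisson μ Z c) {z : ℂ}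
    (hs : Summable fun i => c i * ‖z‖ ^ (i + 1)) :
    ∫ ω, z ^ Z ω ∂μ =
      Complex.exp (∑' i, (c i : ℂ) * z ^ (i + 1) - ((∑' i, c i : ℝ) : ℂ)) := by
  rw [← integral_map (f := fun j : ℕ => z ^ j) h.measurable.aemeasurable
      StronglyMeasurable.of_discrete.aestronglyMeasurable,
    integral_eq_tsum_of_singleton h.mass_nonneg h.map_singleton (h.summable_mass_mul_norm_pow hs),
    sub_eq_add_neg, Complex.exp_add, ← (hasSum_expCoeff_self h.nonneg hs).tsum_eq,
    ← tsum_mul_right]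
  refine tsum_congr fun j => ?_
  rw [Complex.real_smul]
  push_cast
  ring

variable {ρ : ℝ}

theorem mgf_eq (h : IsCompoundPoisson μ Z c) (hs : Summable fun i => c i * ρ ^ (i + 1))
    {s : ℝ} (hsρ : Real.exp s ≤ ρ) :
    ProbabilityTheory.mgf (fun ω => (Z ω : ℝ)) μ s =
      Real.exp (∑' i, c i * Real.exp s ^ (i + 1) - ∑' i, c i) := by
  have hS := summable_mul_exp_of_exp_le h.nonneg hs hsρ
  have := h.integral_pow (z := (Real.exp s : ℝ)) (by rwa [norm_exp_ofReal])
  simp only [ProbabilityTheory.mgf, exp_mul_natCast_eq_pow]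
  rw [← Complex.ofReal_inj, ← integral_complex_ofReal]
  push_cast at this ⊢
  exact this

theorem zero_mem_interior_integrableExpSet (h : IsCompoundPoisson μ Z c) (hρ : 1 < ρ)
    (hs : Summable fun i => c i * ρ ^ (i + 1)) :
    0 ∈ interior (ProbabilityTheory.integrableExpSet (fun ω => (Z ω : ℝ)) μ) := by
  rw [mem_interior_iff_mem_nhds]
  filter_upwards [eventually_exp_le hρ] with s hsρ
  have := h.integrable_pow (z := (Real.exp s : ℝ)) (by
    rw [norm_exp_ofReal]
    exact summable_mul_exp_of_exp_le h.nonneg hs hsρ)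
  have h2 := this.re
  refine h2.congr (Eventually.of_forall fun ω => ?_)
  simp only [exp_mul_natCast_eq_pow]
  rw [← Complex.ofReal_pow]
  exact Complex.ofReal_re _

theorem cgf_eventuallyEq (h : IsCompoundPoisson μ Z c) (hρ : 1 < ρ)
    (hs : Summable fun i => c i * ρ ^ (i + 1)) :
    ProbabilityTheory.cgf (fun ω => (Z ω : ℝ)) μ =ᶠ[nhds 0] fun s =>
      ProbabilityTheory.mgf (fun i : ℕ => (i : ℝ) + 1) (massMeasure c) s - ∑' i, c i := by
  filter_upwards [eventually_exp_le hρ] with s hsρ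
  rw [ProbabilityTheory.cgf, h.mgf_eq hs hsρ, Real.log_exp, mgf_massMeasure h.nonneg hs hsρ]

theorem integral_eq [IsProbabilityMeasure μ] (h : IsCompoundPoisson μ Z c) (hρ : 1 < ρ)
    (hs : Summable fun i => c i * ρ ^ (i + 1)) :
    ∫ ω, (Z ω : ℝ) ∂μ = ∑' i, c i * ((i : ℝ) + 1) := by
  have h1 := ProbabilityTheory.deriv_cgf_zero (h.zero_mem_interior_integrableExpSet hρ hs)
  have h2 := iteratedDeriv_mgf_massMeasure h.nonneg hρ hs 1
  rw [(h.cgf_eventuallyEq hρ hs).deriv_eq, deriv_sub_const, ← iteratedDeriv_one, h2] at h1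
  simpa using h1.symm

theorem variance_eq [IsProbabilityMeasure μ] (h : IsCompoundPoisson μ Z c) (hρ : 1 < ρ)
    (hs : Summable fun i => c i * ρ ^ (i + 1)) :
    ProbabilityTheory.variance (fun ω => (Z ω : ℝ)) μ = ∑' i, c i * ((i : ℝ) + 1) ^ 2 := by
  have hint := h.zero_mem_interior_integrableExpSet hρ hs
  have h1 := ProbabilityTheory.iteratedDeriv_two_cgf_eq_integral hint
  have h2 := iteratedDeriv_mgf_massMeasure h.nonneg hρ hs 2
  have hd : deriv (fun s => ProbabilityTheory.mgf (fun i : ℕ => (i : ℝ) + 1) (massMeasure c) s -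
      ∑' i, c i) = deriv (ProbabilityTheory.mgf (fun i : ℕ => (i : ℝ) + 1) (massMeasure c)) :=
    funext fun s => deriv_sub_const _
  rw [ProbabilityTheory.deriv_cgf_zero hint, (h.cgf_eventuallyEq hρ hs).iteratedDeriv_eq 2,
    iteratedDeriv_succ', hd, ← iteratedDeriv_succ', h2] at h1
  have hm : AEMeasurable (fun ω => (Z ω : ℝ)) μ :=
    ((measurable_from_nat (f := fun n : ℕ => (n : ℝ))).comp h.measurable).aemeasurable
  rw [ProbabilityTheory.variance_eq_integral hm, h1]
  simp

theorem integral_cexp (h : IsCompoundPoisson μ Z c) (hs : Summable c) (τ : ℝ) :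
    ∫ ω, Complex.exp (Complex.I * ((τ * (Z ω : ℝ) : ℝ) : ℂ)) ∂μ =
      Complex.exp (∑' i, (c i : ℂ) * Complex.exp (Complex.I * ((τ * ((i : ℝ) + 1) : ℝ) : ℂ)) -
        ((∑' i, c i : ℝ) : ℂ)) := by
  have hz : ‖Complex.exp (Complex.I * (τ : ℂ))‖ = 1 := Complex.norm_exp_I_mul_ofReal τ
  have := h.integral_pow (z := Complex.exp (Complex.I * (τ : ℂ))) (by simpa [hz] using hs)
  have hpow : ∀ n : ℕ, Complex.exp (Complex.I * ((τ * (n : ℝ) : ℝ) : ℂ)) =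
      Complex.exp (Complex.I * (τ : ℂ)) ^ n := fun n => by
    rw [← Complex.exp_nat_mul]
    push_cast
    ring_nf
  have hpow' : ∀ i : ℕ, Complex.exp (Complex.I * ((τ * ((i : ℝ) + 1) : ℝ) : ℂ)) =
      Complex.exp (Complex.I * (τ : ℂ)) ^ (i + 1) := fun i => by
    rw [← hpow]
    push_cast
    rfl
  simpa only [hpow, hpow'] using this

end IsCompoundPoisson

theorem norm_cexp_sub_taylor_two_le (y : ℝ) :
    ‖Complex.exp (Complex.I * (y : ℂ)) - 1 - Complex.I * y + (y : ℂ) ^ 2 / 2‖ ≤ 4 * |y| ^ 3 := by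
  have hn : ‖Complex.I * (y : ℂ)‖ = |y| := by simp
  have h0 := abs_nonneg y
  rcases le_total |y| 1 with h | h
  · have := Complex.exp_bound (x := Complex.I * y) (hn.trans_le h) (n := 3) (by norm_num)
    rw [hn] at this
    have he : Complex.exp (Complex.I * (y : ℂ)) - 1 - Complex.I * y + (y : ℂ) ^ 2 / 2 =
        Complex.exp (Complex.I * y) -
          ∑ m ∈ Finset.range 3, (Complex.I * (y : ℂ)) ^ m / (m.factorial : ℂ) := by
      simp [Finset.sum_range_succ, mul_pow, Nat.factorial]
      ring
    rw [he]
    refine this.trans ?_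
    norm_num [Nat.factorial]
    nlinarith [pow_nonneg h0 3]
  · have h1 : ‖Complex.exp (Complex.I * (y : ℂ))‖ = 1 := Complex.norm_exp_I_mul_ofReal y
    have h2 : ‖(y : ℂ) ^ 2 / 2‖ = |y| ^ 2 / 2 := by simp
    calc _ ≤ ‖Complex.exp (Complex.I * (y : ℂ))‖ + ‖(1 : ℂ)‖ + ‖Complex.I * (y : ℂ)‖ +
          ‖(y : ℂ) ^ 2 / 2‖ :=
        (norm_add_le _ _).trans <| add_le_add_left ((norm_sub_le _ _).trans <|
          add_le_add_left (norm_sub_le _ _) _) _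
      _ = 2 + |y| + |y| ^ 2 / 2 := by rw [h1, h2, hn, norm_one]; ring
      _ ≤ 4 * |y| ^ 3 := by
        nlinarith [mul_nonneg h0 (sub_nonneg.2 h),
          mul_nonneg (mul_nonneg h0 h0) (sub_nonneg.2 h)]

theorem norm_tsum_cexp_sub_taylor_le {c : ℕ → ℝ} (hc : ∀ i, 0 ≤ c i)
    (hs : ∀ n, Summable fun i => c i * ((i : ℝ) + 1) ^ n) (τ : ℝ) :
    ‖∑' i, (c i : ℂ) * Complex.exp (Complex.I * ((τ * ((i : ℝ) + 1) : ℝ) : ℂ)) -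
        ((∑' i, c i : ℝ) : ℂ) - Complex.I * (τ * ∑' i, c i * ((i : ℝ) + 1) : ℝ) +
        ((τ ^ 2 * ∑' i, c i * ((i : ℝ) + 1) ^ 2 : ℝ) : ℂ) / 2‖ ≤
      4 * |τ| ^ 3 * ∑' i, c i * ((i : ℝ) + 1) ^ 3 := by
  have hs0 : Summable c := by simpa using hs 0
  have hs1 : Summable fun i => c i * ((i : ℝ) + 1) := by simpa using hs 1
  have he : HasSum (fun i => (c i : ℂ) * Complex.exp (Complex.I * ((τ * ((i : ℝ) + 1) : ℝ) : ℂ)))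
      (∑' i, (c i : ℂ) * Complex.exp (Complex.I * ((τ * ((i : ℝ) + 1) : ℝ) : ℂ))) := by
    refine (Summable.of_norm (hs0.congr fun i => ?_)).hasSum
    rw [norm_mul, Complex.norm_exp_I_mul_ofReal, mul_one, Complex.norm_real,
      Real.norm_of_nonneg (hc i)]
  have h0 := Complex.hasSum_ofReal.2 hs0.hasSum
  have h1 := (Complex.hasSum_ofReal.2 (hs1.hasSum.mul_left τ)).mul_left Complex.I
  have h2 := (Complex.hasSum_ofReal.2 ((hs 2).hasSum.mul_left (τ ^ 2))).div_const 2
  have h := ((he.sub h0).sub h1).add h2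
  have h3 := (hs 3).hasSum.mul_left (4 * |τ| ^ 3)
  rw [← h.tsum_eq]
  refine tsum_of_norm_bounded h3 fun i => ?_
  have hpos : (0 : ℝ) < (i : ℝ) + 1 := by positivity
  have key := norm_cexp_sub_taylor_two_le (τ * ((i : ℝ) + 1))
  calc _ = ‖(c i : ℂ) * (Complex.exp (Complex.I * ((τ * ((i : ℝ) + 1) : ℝ) : ℂ)) - 1 -
          Complex.I * ((τ * ((i : ℝ) + 1) : ℝ) : ℂ) +
          ((τ * ((i : ℝ) + 1) : ℝ) : ℂ) ^ 2 / 2)‖ := by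
        congr 1
        push_cast
        ring
    _ ≤ c i * (4 * |τ * ((i : ℝ) + 1)| ^ 3) := by
        rw [norm_mul, Complex.norm_real, Real.norm_of_nonneg (hc i)]
        exact mul_le_mul_of_nonneg_left key (hc i)
    _ = _ := by
        rw [abs_mul, abs_of_pos hpos]
        ring

/-- Lyapunov-type central limit theorem for compound Poisson variables. -/
theorem IsCompoundPoisson.tendsto_charFun_normalized {Ω : Type*} [MeasurableSpace Ω]
    {μ : Measure Ω} [IsProbabilityMeasure μ] {Z : ℕ → Ω → ℕ} {c : ℕ → ℕ → ℝ} {ρ : ℕ → ℝ}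
    (h : ∀ N, IsCompoundPoisson μ (Z N) (c N)) (hρ : ∀ N, 1 < ρ N)
    (hs : ∀ N, Summable fun i => c N i * ρ N ^ (i + 1))
    (hvar : Tendsto (fun N => ProbabilityTheory.variance (fun ω => (Z N ω : ℝ)) μ) atTop atTop)
    {C : ℝ} (hC : ∀ᶠ N in atTop, ∑' i, c N i * ((i : ℝ) + 1) ^ 3 ≤
      C * ∑' i, c N i * ((i : ℝ) + 1) ^ 2) (t : ℝ) :
    Tendsto (fun N => ∫ ω, Complex.exp (Complex.I * (t : ℂ) *
        (((((Z N ω : ℝ) - ∫ ω', (Z N ω' : ℝ) ∂μ) /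
          Real.sqrt (ProbabilityTheory.variance (fun ω => (Z N ω : ℝ)) μ)) : ℝ) : ℂ)) ∂μ)
      atTop (nhds (Complex.exp (-(t : ℂ) ^ 2 / 2))) := by
  have hmom : ∀ N n, Summable fun i => c N i * ((i : ℝ) + 1) ^ n := fun N n =>
    summable_mul_pow_moment (h N).nonneg (hρ N) (hs N) n
  have hm : ∀ N, ∫ ω, (Z N ω : ℝ) ∂μ = ∑' i, c N i * ((i : ℝ) + 1) := fun N =>
    (h N).integral_eq (hρ N) (hs N)
  have hv : ∀ N, ProbabilityTheory.variance (fun ω => (Z N ω : ℝ)) μ =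
      ∑' i, c N i * ((i : ℝ) + 1) ^ 2 := fun N => (h N).variance_eq (hρ N) (hs N)
  simp only [hm, hv] at hvar ⊢
  let m : ℕ → ℝ := fun N => ∑' i, c N i * ((i : ℝ) + 1)
  let v : ℕ → ℝ := fun N => ∑' i, c N i * ((i : ℝ) + 1) ^ 2
  replace hvar : Tendsto v atTop atTop := hvar
  let τ : ℕ → ℝ := fun N => t / Real.sqrt (v N)
  let L : ℕ → ℂ := fun N =>
    ∑' i, (c N i : ℂ) * Complex.exp (Complex.I * ((τ N * ((i : ℝ) + 1) : ℝ) : ℂ)) -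
      ((∑' i, c N i : ℝ) : ℂ) - Complex.I * (τ N * m N : ℝ)
  have hint : ∀ N, ∫ ω, Complex.exp (Complex.I * (t : ℂ) *
      ((((Z N ω : ℝ) - m N) / Real.sqrt (v N) : ℝ) : ℂ)) ∂μ = Complex.exp (L N) := by
    intro N
    have h1 := (h N).integral_cexp (by simpa using hmom N 0) (τ N)
    have h2 : ∀ ω, Complex.exp (Complex.I * (t : ℂ) *
        ((((Z N ω : ℝ) - m N) / Real.sqrt (v N) : ℝ) : ℂ)) =
        Complex.exp (Complex.I * ((τ N * (Z N ω : ℝ) : ℝ) : ℂ)) *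
          Complex.exp (-(Complex.I * (τ N * m N : ℝ))) := by
      intro ω
      rw [← Complex.exp_add]
      congr 1
      simp only [τ]
      push_cast
      ring
    simp_rw [h2]
    rw [integral_mul_const, h1, ← Complex.exp_add, ← sub_eq_add_neg]
  refine Tendsto.congr (fun N => (hint N).symm) ?_
  refine (Complex.continuous_exp.tendsto _).comp ?_
  rw [tendsto_iff_norm_sub_tendsto_zero]
  have hbound : Tendsto (fun N => 4 * |t| ^ 3 * C * (Real.sqrt (v N))⁻¹) atTop (nhds 0) := by
    simpa using (tendsto_inv_atTop_zero.comp
      (Real.tendsto_sqrt_atTop.comp hvar)).const_mul (4 * |t| ^ 3 * C)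
  refine squeeze_zero' (Eventually.of_forall fun _ => norm_nonneg _) ?_ hbound
  filter_upwards [hC, hvar.eventually_gt_atTop 0] with N hN hpos
  have hsq : 0 < Real.sqrt (v N) := Real.sqrt_pos.2 hpos
  have hss : Real.sqrt (v N) ^ 2 = v N := Real.sq_sqrt hpos.le
  have hτ : τ N ^ 2 * v N = t ^ 2 := by
    simp only [τ]
    rw [div_pow, hss, div_mul_cancel₀ _ hpos.ne']
  have key := norm_tsum_cexp_sub_taylor_le (h N).nonneg (hmom N) (τ N)
  change ‖L N + ((τ N ^ 2 * v N : ℝ) : ℂ) / 2‖ ≤ _ at key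
  rw [hτ] at key
  calc ‖L N - -(t : ℂ) ^ 2 / 2‖ = ‖L N + ((t ^ 2 : ℝ) : ℂ) / 2‖ := by
        congr 1
        push_cast
        ring
    _ ≤ 4 * |τ N| ^ 3 * (C * v N) :=
        key.trans (mul_le_mul_of_nonneg_left hN (by positivity))
    _ = 4 * |t| ^ 3 * C * (Real.sqrt (v N))⁻¹ := by
        simp only [τ]
        rw [abs_div, abs_of_pos hsq]
        nth_rewrite 2 [← hss]
        field_simp

/-- For weights `a` with positive first nonzero entry, third moments of the rescaled weights
`a i * q ^ (i + 1)` are dominated by second moments uniformly in `q ∈ [0, 1]`. -/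
theorem exists_third_moment_le_mul_second_moment {a : ℕ → ℝ} (ha : ∀ i, 0 ≤ a i)
    (hs : ∀ n, Summable fun i => a i * ((i : ℝ) + 1) ^ n) (hne : ∃ i, a i ≠ 0) :
    ∃ C : ℝ, ∀ q : ℝ, 0 ≤ q → q ≤ 1 →
      ∑' i, a i * q ^ (i + 1) * ((i : ℝ) + 1) ^ 3 ≤
        C * ∑' i, a i * q ^ (i + 1) * ((i : ℝ) + 1) ^ 2 := by
  classical
  let k := Nat.find hne
  have hk : 0 < a k := lt_of_le_of_ne (ha k) (Nat.find_spec hne).symm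
  have hS : 0 ≤ ∑' i, a i * ((i : ℝ) + 1) ^ 3 :=
    tsum_nonneg fun i => mul_nonneg (ha i) (by positivity)
  have hle : ∀ n (q : ℝ), 0 ≤ q → q ≤ 1 → ∀ i,
      a i * q ^ (i + 1) * ((i : ℝ) + 1) ^ n ≤ q ^ (k + 1) * (a i * ((i : ℝ) + 1) ^ n) := by
    intro n q hq hq1 i
    by_cases hi : i < k
    · have : a i = 0 := not_not.1 (Nat.find_min hne hi)
      simp [this]
    · calc a i * q ^ (i + 1) * ((i : ℝ) + 1) ^ n = q ^ (i + 1) * (a i * ((i : ℝ) + 1) ^ n) := by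
            ring
        _ ≤ _ := mul_le_mul_of_nonneg_right
            (pow_le_pow_of_le_one hq hq1 (by omega)) (mul_nonneg (ha i) (by positivity))
  have hnn : ∀ n (q : ℝ), 0 ≤ q → ∀ i, 0 ≤ a i * q ^ (i + 1) * ((i : ℝ) + 1) ^ n :=
    fun n q hq i => mul_nonneg (mul_nonneg (ha i) (by positivity)) (by positivity)
  have hsum : ∀ n (q : ℝ), 0 ≤ q → q ≤ 1 →
      Summable fun i => a i * q ^ (i + 1) * ((i : ℝ) + 1) ^ n := fun n q hq hq1 =>
    ((hs n).mul_left (q ^ (k + 1))).of_nonneg_of_le (hnn n q hq) (hle n q hq hq1)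
  refine ⟨(∑' i, a i * ((i : ℝ) + 1) ^ 3) / a k, fun q hq hq1 => ?_⟩
  have h2 : a k * q ^ (k + 1) ≤ ∑' i, a i * q ^ (i + 1) * ((i : ℝ) + 1) ^ 2 := by
    refine le_trans ?_ ((hsum 2 q hq hq1).le_tsum k fun i _ => hnn 2 q hq i)
    refine le_mul_of_one_le_right (mul_nonneg hk.le (by positivity)) (one_le_pow₀ ?_)
    linarith [Nat.cast_nonneg (α := ℝ) k]
  calc ∑' i, a i * q ^ (i + 1) * ((i : ℝ) + 1) ^ 3
      ≤ ∑' i, q ^ (k + 1) * (a i * ((i : ℝ) + 1) ^ 3) :=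
        (hsum 3 q hq hq1).tsum_le_tsum (hle 3 q hq hq1) ((hs 3).mul_left _)
    _ = (∑' i, a i * ((i : ℝ) + 1) ^ 3) / a k * (a k * q ^ (k + 1)) := by
        rw [tsum_mul_left]
        field_simp
    _ ≤ _ := mul_le_mul_of_nonneg_left h2 (div_nonneg hS hk.le)

theorem exists_gt_ofReal_lt {r : ℝ} (hr : 0 ≤ r) {u0 : ℝ≥0∞} (h : ENNReal.ofReal r < u0) :
    ∃ s, r < s ∧ ENNReal.ofReal s < u0 := by
  obtain ⟨s, h1, h2⟩ := ENNReal.lt_iff_exists_real_btwn.1 h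
  exact ⟨s, (ENNReal.ofReal_lt_ofReal_iff_of_nonneg hr).1 h2.1, h2.2⟩

/-- Lemma 2.1, asymptotic normality: the characteristic functions of the
normalized auxiliary variables converge to that of the standard normal law. -/
theorem stmt9 {Ω : Type*} [MeasurableSpace Ω] (μ : Measure Ω) [IsProbabilityMeasure μ]
    (V : ℕ → ℝ) (hVpos : ∀ i : ℕ, 1 ≤ i → 0 ≤ V i)
    (u0 : ℝ≥0∞) (hu0 : 0 < u0) (hH : HFinite V u0)
    (x u : ℕ → ℝ) (hx : ∀ N, 0 < x N) (hxinf : Tendsto x atTop atTop)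
    (hu : ∀ N, 0 < u N) (huu0 : ∀ N, ENNReal.ofReal (u N) < u0)
    (uhat : ℝ) (huhat0 : 0 ≤ uhat) (huhatu0 : ENNReal.ofReal uhat < u0)
    (hulim : Tendsto u atTop (nhds uhat))
    (Z : ℕ → Ω → ℕ) (hZmeas : ∀ N, Measurable (Z N))
    (hlaw : ∀ N j : ℕ, μ {ω | Z N ω = j} = ENNReal.ofReal
      (weightedBell V j (x N) * (u N) ^ j /
        ((Nat.factorial j : ℝ) * Real.exp (x N * (weightEGF V (u N) - 1)))))
    (hvar : Tendsto (fun N => ProbabilityTheory.variance (fun ω => (Z N ω : ℝ)) μ)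
      atTop atTop)
    (t : ℝ) :
    Tendsto (fun N => ∫ ω, Complex.exp (Complex.I * (t : ℂ) *
        (((((Z N ω : ℝ) - ∫ ω', (Z N ω' : ℝ) ∂μ) /
          Real.sqrt (ProbabilityTheory.variance (fun ω => (Z N ω : ℝ)) μ)) : ℝ) : ℂ)) ∂μ)
      atTop (nhds (Complex.exp (-(t : ℂ) ^ 2 / 2))) := by
  have hV : ∀ i, 0 ≤ V (i + 1) := fun i => hVpos (i + 1) (Nat.le_add_left 1 i)
  let c : ℕ → ℕ → ℝ := fun N i => x N * V (i + 1) * u N ^ (i + 1) / (Nat.factorial (i + 1) : ℝ)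
  have hc : ∀ N i, 0 ≤ c N i := fun N i => by
    have := hx N
    have := hV i
    have := hu N
    positivity
  have hZ : ∀ N, IsCompoundPoisson μ (Z N) (c N) := by
    refine fun N => ⟨hZmeas N, hc N, fun j => ?_⟩
    have hsum : ∑' i, c N i = x N * (weightEGF V (u N) - 1) := by
      rw [weightEGF, add_sub_cancel_left, ← tsum_mul_left]
      exact tsum_congr fun i => by simp only [c]; ring
    rw [hlaw, hsum, Real.exp_neg, ← weightedBell_mul_pow_div_factorial]
    congr 1
    field_simp
  choose s hus hsu0 using fun N => exists_gt_ofReal_lt (hu N).le (huu0 N)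
  have hρ : ∀ N, 1 < s N / u N := fun N => (one_lt_div (hu N)).2 (hus N)
  have hcs : ∀ N, Summable fun i => c N i * (s N / u N) ^ (i + 1) := fun N => by
    refine ((hH (s N) ((hu N).trans (hus N)).le (hsu0 N)).mul_left (x N)).congr fun i => ?_
    have := (hu N).ne'
    simp only [c]
    rw [div_pow]
    field_simp
  obtain ⟨r, hr, hru0⟩ := exists_gt_ofReal_lt huhat0 huhatu0
  have hr0 : 0 < r := huhat0.trans_lt hr
  obtain ⟨r', hrr', hr'u0⟩ := exists_gt_ofReal_lt hr0.le hru0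
  let a : ℕ → ℝ := fun i => V (i + 1) * r ^ (i + 1) / (Nat.factorial (i + 1) : ℝ)
  have ha : ∀ i, 0 ≤ a i := fun i => by
    have := hV i
    positivity
  have has : ∀ n, Summable fun i => a i * ((i : ℝ) + 1) ^ n := by
    refine summable_mul_pow_moment ha ((one_lt_div hr0).2 hrr') ?_
    refine (hH r' (hr0.trans hrr').le hr'u0).congr fun i => ?_
    simp only [a]
    rw [div_pow]
    field_simp
  have hca : ∀ N i, c N i = x N * (a i * (u N / r) ^ (i + 1)) := fun N i => by
    simp only [c, a]
    rw [div_pow]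
    field_simp
  have hne : ∃ i, a i ≠ 0 := by
    by_contra! h0
    obtain ⟨N, hN⟩ := (hvar.eventually_gt_atTop 0).exists
    rw [(hZ N).variance_eq (hρ N) (hcs N)] at hN
    simp [hca, h0] at hN
  obtain ⟨C, hC⟩ := exists_third_moment_le_mul_second_moment ha has hne
  refine IsCompoundPoisson.tendsto_charFun_normalized hZ hρ hcs hvar (C := C) ?_ t
  filter_upwards [hulim.eventually_lt_const hr] with N hN
  simp only [hca, mul_assoc (x N), tsum_mul_left]
  rw [mul_left_comm]
  exact mul_le_mul_of_nonneg_left (hC _ (div_nonneg (hu N).le hr0.le)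
    ((div_le_one hr0).2 hN.le)) (hx N).le

end
end

section
/- (Gaussian weights, relation (3.6).) Let V_2 > 0 and take the Gaussian weight moments V_{2j} = V_2^j·(2j−1)!! and V_{2j+1} = 0 for all j ≥ 0 (the moments of the centered normal law of variance V_2), so that H(u) = exp( V_2·u²/2 ). Let χ > 0, let β > 0 be the solution of the Lambert equation β·e^β = 1/χ, set A = exp( (e^β − 1)/(β·e^β) − 2 ), and set x_k = χ·k. Then ( M_{2k}(x_k) )^{1/k} · β / ( 2·k²·A·V_2 ) → 1 as k → ∞. -/
open scoped BigOperators ENNReal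
open Filter MeasureTheory

noncomputable section

open scoped Nat

lemma coeff_mk_pow (c : ℕ → ℝ) (n m : ℕ) :
    PowerSeries.coeff n ((PowerSeries.mk c) ^ m) =
      ∑ q ∈ Finset.piAntidiag (Finset.univ : Finset (Fin (n + 1))) m,
        if ∑ i, i.1 * q i = n then
          (Nat.multinomial Finset.univ q : ℝ) * ∏ i : Fin (n + 1), c i.1 ^ q i else 0 := by
  have htrunc : PowerSeries.trunc (n + 1) (PowerSeries.mk c) =
      ∑ i : Fin (n + 1), Polynomial.monomial i.1 (c i.1) := by
    rw [PowerSeries.trunc_apply, Nat.Ico_zero_eq_range,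
      Fin.sum_univ_eq_sum_range (fun i => Polynomial.monomial i (c i))]
    simp only [PowerSeries.coeff_mk]
  have hcoeff : PowerSeries.coeff n ((PowerSeries.mk c) ^ m) =
      ((∑ i : Fin (n + 1), Polynomial.monomial i.1 (c i.1)) ^ m).coeff n := by
    rw [← htrunc, ← Polynomial.coeff_coe, Polynomial.coe_pow,
      ← PowerSeries.coeff_coe_trunc_of_lt (Nat.lt_succ_self n), ← PowerSeries.trunc_trunc_pow,
      PowerSeries.coeff_coe_trunc_of_lt (Nat.lt_succ_self n)]
  rw [hcoeff, Finset.sum_pow_eq_sum_piAntidiag, Polynomial.finsetSum_coeff]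
  refine Finset.sum_congr rfl fun q _ => ?_
  have hprod : ∏ i : Fin (n + 1), (Polynomial.monomial i.1 (c i.1)) ^ q i =
      Polynomial.monomial (∑ i, i.1 * q i) (∏ i, c i.1 ^ q i) := by
    simp only [← Polynomial.C_mul_X_pow_eq_monomial, mul_pow, ← pow_mul, ← map_pow,
      Finset.prod_mul_distrib, Finset.prod_pow_eq_pow_sum, map_prod]
  rw [hprod, ← Polynomial.C_eq_natCast, Polynomial.coeff_C_mul, Polynomial.coeff_monomial,
    mul_ite, mul_zero]

lemma pow_mul_coeff_mk_pow_le (c : ℕ → ℝ) (hc : ∀ i, 0 ≤ c i) (hc0 : c 0 = 1)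
    (x : ℝ) (hx : 0 ≤ x) (n m : ℕ) :
    x ^ m / (m ! : ℝ) * PowerSeries.coeff n ((PowerSeries.mk c) ^ m) ≤
      Real.exp x * ∑ l ∈ bellTuples n, ∏ i : Fin n, (x * c (i.1 + 1)) ^ l i / (l i)! := by
  set w : (Fin n → ℕ) → ℝ := fun l => ∏ i : Fin n, (x * c (i.1 + 1)) ^ l i / (l i)! with hw
  have hw_nonneg : ∀ l, 0 ≤ w l := fun l =>
    Finset.prod_nonneg fun i _ => div_nonneg (pow_nonneg (mul_nonneg hx (hc _)) _) (by positivity)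
  have hterm : ∀ q ∈ Finset.piAntidiag (Finset.univ : Finset (Fin (n + 1))) m,
      x ^ m / (m ! : ℝ) * ((Nat.multinomial Finset.univ q : ℝ) * ∏ i : Fin (n + 1), c i.1 ^ q i) =
        x ^ q 0 / (q 0)! * w (Fin.tail q) := by
    intro q hq
    have hsum : ∑ i, q i = m := (Finset.mem_piAntidiag.mp hq).1
    have hmul : (∏ i, ((q i)! : ℝ)) * (Nat.multinomial Finset.univ q : ℝ) = (m ! : ℝ) := by
      have := Nat.multinomial_spec (Finset.univ : Finset (Fin (n + 1))) q
      rw [hsum] at this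
      exact_mod_cast this
    have hpos : (∏ i, ((q i)! : ℝ)) ≠ 0 := Finset.prod_ne_zero_iff.mpr fun i _ => by positivity
    have hm : (m ! : ℝ) ≠ 0 := by positivity
    have hall : x ^ q 0 / (q 0)! * w (Fin.tail q) =
        ∏ i : Fin (n + 1), (x * c i.1) ^ q i / ((q i)! : ℝ) := by
      rw [Fin.prod_univ_succ]
      simp [hw, Fin.tail, hc0]
    rw [hall, Finset.prod_div_distrib]
    simp only [mul_pow, Finset.prod_mul_distrib]
    rw [Finset.prod_pow_eq_pow_sum, hsum, ← hmul]
    rw [← hmul] at hm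
    have hmult : (Nat.multinomial Finset.univ q : ℝ) ≠ 0 := right_ne_zero_of_mul hm
    field_simp
  rw [coeff_mk_pow, ← Finset.sum_filter, Finset.mul_sum]
  set S := (Finset.piAntidiag (Finset.univ : Finset (Fin (n + 1))) m).filter
      (fun q => ∑ i, i.1 * q i = n) with hS
  have hsubst : ∀ q ∈ S,
      (q 0, Fin.tail q) ∈ Finset.range (m + 1) ×ˢ bellTuples n := by
    intro q hq
    obtain ⟨hq, hqn⟩ := Finset.mem_filter.mp hq
    have hsum : ∑ i, q i = m := (Finset.mem_piAntidiag.mp hq).1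
    have htail : ∑ i : Fin n, (i.1 + 1) * Fin.tail q i = n := by
      rw [Fin.sum_univ_succ] at hqn
      simpa [Fin.tail] using hqn
    refine Finset.mem_product.mpr ⟨?_, Finset.mem_filter.mpr ⟨?_, htail⟩⟩
    · have := Finset.single_le_sum (f := q) (fun _ _ => Nat.zero_le _) (Finset.mem_univ 0)
      simp only [Finset.mem_range]
      omega
    · refine Fintype.mem_piFinset.mpr fun i => ?_
      have := Finset.single_le_sum (f := fun i : Fin n => (i.1 + 1) * Fin.tail q i)
        (fun _ _ => Nat.zero_le _) (Finset.mem_univ i)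
      simp only [htail] at this
      simp only [Finset.mem_range]
      nlinarith
  calc _ = ∑ q ∈ S, x ^ q 0 / (q 0)! * w (Fin.tail q) :=
        Finset.sum_congr rfl fun q hq => hterm q (Finset.mem_filter.mp hq).1
    _ = ∑ p ∈ S.image (fun q => (q 0, Fin.tail q)),
        x ^ p.1 / (p.1)! * w p.2 := by
        rw [Finset.sum_image]
        intro q _ q' _ h
        obtain ⟨h0, ht⟩ := Prod.mk.inj h
        rw [← Fin.cons_self_tail q, ← Fin.cons_self_tail q', h0, ht]
    _ ≤ ∑ p ∈ Finset.range (m + 1) ×ˢ bellTuples n, x ^ p.1 / (p.1)! * w p.2 := by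
        refine Finset.sum_le_sum_of_subset_of_nonneg (Finset.image_subset_iff.mpr hsubst) ?_
        intro p _ _
        exact mul_nonneg (by positivity) (hw_nonneg _)
    _ = (∑ j ∈ Finset.range (m + 1), x ^ j / (j ! : ℝ)) * ∑ l ∈ bellTuples n, w l := by
        rw [Finset.sum_product, Finset.sum_mul_sum]
    _ ≤ _ := mul_le_mul_of_nonneg_right (Real.sum_le_exp_of_nonneg hx _)
        (Finset.sum_nonneg fun l _ => hw_nonneg l)

lemma sum_bellTuples_mul_pow_le (c : ℕ → ℝ) (hc : ∀ i, 0 ≤ c i)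
    (x : ℝ) (hx : 0 ≤ x) (u : ℝ) (hu : 0 ≤ u) (n : ℕ) :
    (∑ l ∈ bellTuples n, ∏ i : Fin n, (x * c (i.1 + 1)) ^ l i / ((l i)! : ℝ)) * u ^ n ≤
      Real.exp (x * ∑ i ∈ Finset.range n, c (i + 1) * u ^ (i + 1)) := by
  have hnn : ∀ i : ℕ, 0 ≤ x * c (i + 1) * u ^ (i + 1) := fun i =>
    mul_nonneg (mul_nonneg hx (hc _)) (pow_nonneg hu _)
  calc _ = ∑ l ∈ bellTuples n, ∏ i : Fin n,
        (x * c (i.1 + 1) * u ^ (i.1 + 1)) ^ l i / ((l i)! : ℝ) := by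
        rw [Finset.sum_mul]
        refine Finset.sum_congr rfl fun l hl => ?_
        have hl : ∑ i : Fin n, (i.1 + 1) * l i = n := (Finset.mem_filter.mp hl).2
        calc _ = (∏ i : Fin n, (x * c (i.1 + 1)) ^ l i / ((l i)! : ℝ)) *
              ∏ i : Fin n, u ^ ((i.1 + 1) * l i) := by
              rw [Finset.prod_pow_eq_pow_sum, hl]
          _ = _ := by
              rw [← Finset.prod_mul_distrib]
              refine Finset.prod_congr rfl fun i _ => ?_
              rw [pow_mul, mul_pow (x * c (i.1 + 1))]
              ring
    _ ≤ ∑ l ∈ Fintype.piFinset fun _ : Fin n => Finset.range (n + 1), ∏ i : Fin n,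
        (x * c (i.1 + 1) * u ^ (i.1 + 1)) ^ l i / ((l i)! : ℝ) :=
        Finset.sum_le_sum_of_subset_of_nonneg (Finset.filter_subset _ _) fun l _ _ =>
          Finset.prod_nonneg fun i _ => div_nonneg (pow_nonneg (hnn _) _) (by positivity)
    _ = ∏ i : Fin n, ∑ j ∈ Finset.range (n + 1),
        (x * c (i.1 + 1) * u ^ (i.1 + 1)) ^ j / (j ! : ℝ) :=
        (Finset.prod_univ_sum (fun _ : Fin n => Finset.range (n + 1))
          (fun i j => (x * c (i.1 + 1) * u ^ (i.1 + 1)) ^ j / (j ! : ℝ))).symm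
    _ ≤ ∏ i : Fin n, Real.exp (x * c (i.1 + 1) * u ^ (i.1 + 1)) :=
        Finset.prod_le_prod
          (fun i _ => Finset.sum_nonneg fun j _ => div_nonneg (pow_nonneg (hnn _) _) (by positivity))
          fun i _ => Real.sum_le_exp_of_nonneg (hnn _) _
    _ = _ := by
        rw [← Real.exp_sum, Finset.mul_sum,
          ← Fin.sum_univ_eq_sum_range (fun i => x * (c (i + 1) * u ^ (i + 1)))]
        simp only [mul_assoc]

/-- Coefficients of `exp (a u²)`. -/
def gaussCoeff (a : ℝ) (i : ℕ) : ℝ := if 2 ∣ i then a ^ (i / 2) / ((i / 2)! : ℝ) else 0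

lemma gaussCoeff_nonneg {a : ℝ} (ha : 0 ≤ a) (i : ℕ) : 0 ≤ gaussCoeff a i := by
  unfold gaussCoeff
  split_ifs <;> positivity

lemma gaussCoeff_two_mul (a : ℝ) (j : ℕ) : gaussCoeff a (2 * j) = a ^ j / (j ! : ℝ) := by
  simp [gaussCoeff]

lemma gaussCoeff_two_mul_add_one (a : ℝ) (j : ℕ) : gaussCoeff a (2 * j + 1) = 0 := by
  rw [gaussCoeff, if_neg (by omega)]

lemma coeff_mk_gaussCoeff_pow (a : ℝ) (k m : ℕ) :
    PowerSeries.coeff (2 * k) ((PowerSeries.mk (gaussCoeff a)) ^ m) =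
      a ^ k * (m : ℝ) ^ k / (k ! : ℝ) := by
  have hmk : PowerSeries.mk (gaussCoeff a) = PowerSeries.expand 2 two_ne_zero
      (PowerSeries.rescale a (PowerSeries.exp ℝ)) := by
    ext i
    rw [PowerSeries.coeff_mk, PowerSeries.coeff_expand, gaussCoeff]
    simp [PowerSeries.coeff_rescale, PowerSeries.coeff_exp, div_eq_mul_inv]
  rw [hmk, ← map_pow, ← map_pow, PowerSeries.exp_pow_eq_rescale_exp,
    PowerSeries.coeff_expand_mul, PowerSeries.coeff_rescale, PowerSeries.coeff_rescale,
    PowerSeries.coeff_exp]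
  simp [div_eq_mul_inv, mul_assoc]

lemma sum_gaussCoeff_le {a : ℝ} (ha : 0 ≤ a) (u : ℝ) (k : ℕ) :
    ∑ i ∈ Finset.range (2 * k), gaussCoeff a (i + 1) * u ^ (i + 1) ≤
      Real.exp (a * u ^ 2) - 1 := by
  have hsum : 1 + ∑ i ∈ Finset.range (2 * k), gaussCoeff a (i + 1) * u ^ (i + 1) =
      ∑ j ∈ Finset.range (k + 1), (a * u ^ 2) ^ j / (j ! : ℝ) := by
    induction k with
    | zero => simp
    | succ k ih =>
      rw [Finset.sum_range_succ _ (k + 1), ← ih, show 2 * (k + 1) = 2 * k + 1 + 1 by ring,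
        Finset.sum_range_succ, Finset.sum_range_succ, gaussCoeff_two_mul_add_one,
        show 2 * k + 1 + 1 = 2 * (k + 1) by ring, gaussCoeff_two_mul]
      ring
  have := Real.sum_le_exp_of_nonneg (x := a * u ^ 2) (by positivity) (k + 1)
  linarith

lemma factorial_two_mul_eq (j : ℕ) :
    (2 * j)! = 2 ^ j * j ! * Nat.doubleFactorial (2 * j - 1) := by
  cases j with
  | zero => simp
  | succ j =>
    rw [← Nat.doubleFactorial_two_mul, show 2 * (j + 1) = 2 * j + 1 + 1 by ring,
      Nat.factorial_eq_mul_doubleFactorial]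
    rfl

lemma weightedBell_eq_gaussCoeff (V2 : ℝ) (V : ℕ → ℝ)
    (hVeven : ∀ j : ℕ, V (2 * j) = V2 ^ j * (Nat.doubleFactorial (2 * j - 1) : ℝ))
    (hVodd : ∀ j : ℕ, V (2 * j + 1) = 0) (n : ℕ) (x : ℝ) :
    weightedBell V n x = (n ! : ℝ) * ∑ l ∈ bellTuples n, ∏ i : Fin n,
      (x * gaussCoeff (V2 / 2) (i.1 + 1)) ^ l i / ((l i)! : ℝ) := by
  have hV : ∀ i, V i / (i ! : ℝ) = gaussCoeff (V2 / 2) i := by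
    intro i
    obtain ⟨j, rfl | rfl⟩ := Nat.even_or_odd' i
    · rw [hVeven, gaussCoeff_two_mul, factorial_two_mul_eq]
      have : (Nat.doubleFactorial (2 * j - 1) : ℝ) ≠ 0 :=
        Nat.cast_ne_zero.mpr (Nat.doubleFactorial_pos _).ne'
      rw [div_pow]
      push_cast
      field_simp
    · rw [hVodd, gaussCoeff_two_mul_add_one, zero_div]
  unfold weightedBell
  congr 1
  refine Finset.sum_congr rfl fun l _ => Finset.prod_congr rfl fun i _ => ?_
  rw [← hV, ← mul_div_assoc, div_pow, div_div]

/-- The normalised Stirling error `(log n! - n log n + n) / n`. -/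
def stirlingError (n : ℕ) : ℝ := (Real.log (n ! : ℝ) - n * Real.log n + n) / n

lemma tendsto_stirlingError : Tendsto stirlingError atTop (nhds 0) := by
  have hcast : Tendsto (fun n : ℕ => (n : ℝ)) atTop atTop := tendsto_natCast_atTop_atTop
  have h1 : Tendsto (fun n : ℕ => Real.log (Stirling.stirlingSeq n) / (n : ℝ)) atTop (nhds 0) :=
    (Stirling.tendsto_stirlingSeq_sqrt_pi.log (by positivity)).div_atTop hcast
  have h2 : Tendsto (fun n : ℕ => Real.log (2 * (n : ℝ)) / (2 * (n : ℝ))) atTop (nhds 0) :=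
    Real.isLittleO_log_id_atTop.tendsto_div_nhds_zero.comp (hcast.const_mul_atTop two_pos)
  have h := h1.add h2
  rw [add_zero] at h
  refine h.congr' ?_
  filter_upwards [eventually_gt_atTop 0] with n hn
  have hn' : (0 : ℝ) < n := Nat.cast_pos.mpr hn
  rw [Stirling.log_stirlingSeq_formula, stirlingError,
    Real.log_div hn'.ne' (Real.exp_ne_zero 1), Real.log_exp]
  field_simp
  ring

lemma log_factorial_eq {n : ℕ} (hn : 0 < n) :
    Real.log (n ! : ℝ) = n * Real.log n - n + n * stirlingError n := by
  have hn' : (n : ℝ) ≠ 0 := Nat.cast_ne_zero.mpr hn.ne'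
  rw [stirlingError]
  field_simp
  ring

section Bounds

variable {V2 χ β : ℝ} {V : ℕ → ℝ}

lemma weightedBell_two_mul_le (hV2 : 0 < V2)
    (hVeven : ∀ j : ℕ, V (2 * j) = V2 ^ j * (Nat.doubleFactorial (2 * j - 1) : ℝ))
    (hVodd : ∀ j : ℕ, V (2 * j + 1) = 0) (hβ : 0 < β) {x : ℝ} (hx : 0 ≤ x) (k : ℕ) :
    weightedBell V (2 * k) x ≤
      ((2 * k)! : ℝ) * (V2 / (2 * β)) ^ k * Real.exp (x * (Real.exp β - 1)) := by
  have ha : 0 ≤ V2 / 2 := by positivity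
  set u := Real.sqrt (2 * β / V2) with hu
  have hu2 : u ^ 2 = 2 * β / V2 := Real.sq_sqrt (by positivity)
  have hau : V2 / 2 * u ^ 2 = β := by rw [hu2]; field_simp
  have h := sum_bellTuples_mul_pow_le (gaussCoeff (V2 / 2)) (gaussCoeff_nonneg ha) x hx u
    (Real.sqrt_nonneg _) (2 * k)
  have hs := sum_gaussCoeff_le ha u k
  rw [hau] at hs
  rw [weightedBell_eq_gaussCoeff V2 V hVeven hVodd, mul_assoc]
  refine mul_le_mul_of_nonneg_left ?_ (by positivity)
  have hpow : 0 < u ^ (2 * k) := by rw [pow_mul, hu2]; positivity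
  have hinv : (V2 / (2 * β)) ^ k * u ^ (2 * k) = 1 := by
    rw [pow_mul, hu2, ← mul_pow]
    convert one_pow k using 2
    field_simp
  refine le_of_mul_le_mul_right ?_ hpow
  calc _ ≤ _ := h
    _ ≤ Real.exp (x * (Real.exp β - 1)) :=
        Real.exp_le_exp.mpr (mul_le_mul_of_nonneg_left hs hx)
    _ = (V2 / (2 * β)) ^ k * u ^ (2 * k) * Real.exp (x * (Real.exp β - 1)) := by
        rw [hinv, one_mul]
    _ = _ := by ring

lemma le_weightedBell_two_mul (hV2 : 0 < V2)
    (hVeven : ∀ j : ℕ, V (2 * j) = V2 ^ j * (Nat.doubleFactorial (2 * j - 1) : ℝ))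
    (hVodd : ∀ j : ℕ, V (2 * j + 1) = 0) {x : ℝ} (hx : 0 ≤ x) (k m : ℕ) :
    ((2 * k)! : ℝ) * (x ^ m / (m ! : ℝ) * ((V2 / 2) ^ k * (m : ℝ) ^ k / (k ! : ℝ))) *
      Real.exp (-x) ≤ weightedBell V (2 * k) x := by
  have ha : 0 ≤ V2 / 2 := by positivity
  have h := pow_mul_coeff_mk_pow_le (gaussCoeff (V2 / 2)) (gaussCoeff_nonneg ha)
    (by simp [gaussCoeff]) x hx (2 * k) m
  rw [coeff_mk_gaussCoeff_pow] at h
  rw [weightedBell_eq_gaussCoeff V2 V hVeven hVodd, mul_assoc]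
  refine mul_le_mul_of_nonneg_left ?_ (by positivity)
  rw [Real.exp_neg, ← div_eq_mul_inv, div_le_iff₀ (Real.exp_pos x), mul_comm _ (Real.exp x)]
  exact h

/-- Rewritings of the constants through the Lambert equation. -/
lemma exponent_eq_of_lambert (hχ : 0 < χ) (hβ : 0 < β) (hLambert : β * Real.exp β = 1 / χ) :
    (Real.exp β - 1) / (β * Real.exp β) - 2 = 1 / β - χ - 2 ∧
      χ * (Real.exp β - 1) = 1 / β - χ ∧ Real.log χ + Real.log β = -β := by
  have hmul : χ * Real.exp β = 1 / β := by
    field_simp at hLambert ⊢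
    linarith
  refine ⟨?_, by rw [mul_sub, hmul, mul_one], ?_⟩
  · rw [hLambert, div_div_eq_mul_div, div_one, sub_mul, mul_comm (Real.exp β), hmul, one_mul]
  · have h := congrArg Real.log hLambert
    rw [Real.log_mul hβ.ne' (Real.exp_ne_zero β), Real.log_exp, one_div, Real.log_inv] at h
    linarith

/-- The normalised `k`-th root of a positive number, in exponential form. -/
lemma normalised_root_eq_exp {M : ℝ} (hM : 0 < M) (hV2 : 0 < V2) (hβ : 0 < β) {k : ℕ}
    (hk : 0 < k) (E : ℝ) :
    M ^ ((k : ℝ)⁻¹) * β / (2 * (k : ℝ) ^ 2 * Real.exp E * V2) =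
      Real.exp (Real.log M / k + Real.log β - Real.log 2 - 2 * Real.log k - E - Real.log V2) := by
  have hk' : (0 : ℝ) < k := Nat.cast_pos.mpr hk
  rw [Real.rpow_def_of_pos hM]
  simp only [Real.exp_sub, Real.exp_add, Real.exp_log hβ, Real.exp_log hV2, Real.exp_log two_pos,
    two_mul (Real.log (k : ℝ)), Real.exp_log hk', ← div_eq_mul_inv]
  field_simp

/-- Logarithm of the normalised lower bound coming from the `m`-th Dobinski term, with
`m = ρ k`. -/
def dobinskiExponent (χ β ρ r₁ r₂ r₃ : ℝ) : ℝ :=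
  1 + r₁ + Real.log ρ + ρ * Real.log χ - ρ * Real.log ρ + ρ - ρ * r₂ - r₃ + Real.log β - 1 / β

lemma dobinskiExponent_eq (hV2 : 0 < V2) (hχ : 0 < χ) {k m : ℕ} (hk : 0 < k)
    (hm : 0 < m) :
    Real.log (((2 * k)! : ℝ) * ((χ * k) ^ m / (m ! : ℝ) *
        ((V2 / 2) ^ k * (m : ℝ) ^ k / (k ! : ℝ))) * Real.exp (-(χ * k))) / k
        + Real.log β - Real.log 2 - 2 * Real.log k - (1 / β - χ - 2) - Real.log V2 =
      dobinskiExponent χ β (m / k) (2 * stirlingError (2 * k)) (stirlingError m)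
        (stirlingError k) := by
  have hk' : (0 : ℝ) < k := Nat.cast_pos.mpr hk
  have hm' : (0 : ℝ) < m := Nat.cast_pos.mpr hm
  have hlog : Real.log (((2 * k)! : ℝ) * ((χ * k) ^ m / (m ! : ℝ) *
        ((V2 / 2) ^ k * (m : ℝ) ^ k / (k ! : ℝ))) * Real.exp (-(χ * k))) =
      Real.log ((2 * k)! : ℝ) + (m * (Real.log χ + Real.log k) - Real.log (m ! : ℝ) +
        (k * (Real.log V2 - Real.log 2) + k * Real.log m - Real.log (k ! : ℝ))) - χ * k := by
    rw [Real.log_mul (by positivity) (by positivity), Real.log_mul (by positivity) (by positivity),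
      Real.log_mul (by positivity) (by positivity), Real.log_div (by positivity) (by positivity),
      Real.log_div (by positivity) (by positivity), Real.log_mul (by positivity) (by positivity),
      Real.log_pow, Real.log_pow, Real.log_pow, Real.log_exp, Real.log_mul hχ.ne' hk'.ne',
      Real.log_div hV2.ne' two_ne_zero]
    ring
  rw [hlog, log_factorial_eq (by omega : 0 < 2 * k), log_factorial_eq hm, log_factorial_eq hk,
    dobinskiExponent, Real.log_div hm'.ne' hk'.ne']
  push_cast
  rw [Real.log_mul two_ne_zero hk'.ne']
  generalize stirlingError (2 * k) = a
  generalize 1 / β = b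
  field_simp
  ring

lemma upperExponent_eq (hV2 : 0 < V2) (hβ : 0 < β) (hχe : χ * (Real.exp β - 1) = 1 / β - χ)
    {k : ℕ} (hk : 0 < k) :
    Real.log (((2 * k)! : ℝ) * (V2 / (2 * β)) ^ k * Real.exp (χ * k * (Real.exp β - 1))) / k
        + Real.log β - Real.log 2 - 2 * Real.log k - (1 / β - χ - 2) - Real.log V2 =
      2 * stirlingError (2 * k) := by
  have hk' : (0 : ℝ) < k := Nat.cast_pos.mpr hk
  have hlog : Real.log (((2 * k)! : ℝ) * (V2 / (2 * β)) ^ k *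
        Real.exp (χ * k * (Real.exp β - 1))) =
      Real.log ((2 * k)! : ℝ) + k * (Real.log V2 - (Real.log 2 + Real.log β)) +
        k * (1 / β - χ) := by
    rw [Real.log_mul (by positivity) (by positivity), Real.log_mul (by positivity) (by positivity),
      Real.log_pow, Real.log_exp, Real.log_div hV2.ne' (by positivity),
      Real.log_mul two_ne_zero hβ.ne', ← hχe]
    ring
  rw [hlog, log_factorial_eq (by omega : 0 < 2 * k)]
  push_cast
  rw [Real.log_mul two_ne_zero hk'.ne']
  generalize stirlingError (2 * k) = a
  generalize 1 / β = b
  field_simp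
  ring

lemma tendsto_dobinskiExponent (hβ : 0 < β) (hlog : Real.log χ + Real.log β = -β)
    {ρ r₁ r₂ r₃ : ℕ → ℝ} (hρ : Tendsto ρ atTop (nhds (1 / β))) (h₁ : Tendsto r₁ atTop (nhds 0))
    (h₂ : Tendsto r₂ atTop (nhds 0)) (h₃ : Tendsto r₃ atTop (nhds 0)) :
    Tendsto (fun k => dobinskiExponent χ β (ρ k) (r₁ k) (r₂ k) (r₃ k)) atTop (nhds 0) := by
  have hρlog := hρ.log (by positivity)
  have h := ((((((((h₁.const_add 1).add hρlog).add (hρ.mul_const (Real.log χ))).sub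
    (hρ.mul hρlog)).add hρ).sub (hρ.mul h₂)).sub h₃).add_const (Real.log β)).sub_const (1 / β)
  have hχlog : Real.log χ = -β - Real.log β := by linarith
  have hlim : 1 + 0 + Real.log (1 / β) + 1 / β * Real.log χ - 1 / β * Real.log (1 / β) + 1 / β
      - 1 / β * 0 - 0 + Real.log β - 1 / β = 0 := by
    rw [one_div, Real.log_inv, hχlog]
    field_simp
    ring
  rw [hlim] at h
  exact h

end Bounds

/-- Gaussian weights, relation (3.6): for the moments of the centered normal
law of variance `V₂`, `(M_{2k}(χ k))^{1/k} → 2 k² A V₂ / β` where `β e^β = 1/χ` and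
`A = exp((e^β − 1)/(β e^β) − 2)`. -/
theorem stmt11 (V2 : ℝ) (hV2 : 0 < V2) (V : ℕ → ℝ)
    (hVeven : ∀ j : ℕ, V (2 * j) = V2 ^ j * (Nat.doubleFactorial (2 * j - 1) : ℝ))
    (hVodd : ∀ j : ℕ, V (2 * j + 1) = 0)
    (χ : ℝ) (hχ : 0 < χ) (β : ℝ) (hβ : 0 < β) (hLambert : β * Real.exp β = 1 / χ) :
    Tendsto (fun k : ℕ => (weightedBell V (2 * k) (χ * k)) ^ ((k : ℝ)⁻¹) * β /
        (2 * (k : ℝ) ^ 2 * Real.exp ((Real.exp β - 1) / (β * Real.exp β) - 2) * V2))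
      atTop (nhds 1) := by
  obtain ⟨hE, hχe, hlog⟩ := exponent_eq_of_lambert hχ hβ hLambert
  rw [hE]
  set m : ℕ → ℕ := fun k => ⌈1 / β * (k : ℝ)⌉₊ with hm_def
  have hρ : Tendsto (fun k : ℕ => (m k : ℝ) / k) atTop (nhds (1 / β)) :=
    (tendsto_nat_ceil_mul_div_atTop (by positivity : (0 : ℝ) ≤ 1 / β)).comp
      tendsto_natCast_atTop_atTop
  have hm : Tendsto m atTop atTop :=
    tendsto_nat_ceil_atTop.comp
      (tendsto_natCast_atTop_atTop.const_mul_atTop (by positivity : (0 : ℝ) < 1 / β))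
  have hr₁ : Tendsto (fun k : ℕ => 2 * stirlingError (2 * k)) atTop (nhds 0) := by
    have := (tendsto_stirlingError.comp
      (tendsto_id.const_mul_atTop' (two_pos : (0 : ℕ) < 2))).const_mul 2
    simpa using this
  have hlower := (tendsto_dobinskiExponent hβ hlog hρ hr₁ (tendsto_stirlingError.comp hm)
    tendsto_stirlingError).rexp
  have hupper := hr₁.rexp
  rw [Real.exp_zero] at hlower hupper
  refine tendsto_of_tendsto_of_tendsto_of_le_of_le' hlower hupper ?_ ?_
  all_goals
    filter_upwards [eventually_gt_atTop 0, hm.eventually_gt_atTop 0] with k hk hmk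
    have hk' : (0 : ℝ) < k := Nat.cast_pos.mpr hk
    have hmk' : (0 : ℝ) < m k := Nat.cast_pos.mpr hmk
    have hle := le_weightedBell_two_mul hV2 hVeven hVodd (by positivity : 0 ≤ χ * k) k (m k)
    have hL : 0 < ((2 * k)! : ℝ) * ((χ * k) ^ m k / ((m k)! : ℝ) *
        ((V2 / 2) ^ k * (m k : ℝ) ^ k / (k ! : ℝ))) * Real.exp (-(χ * k)) := by positivity
    have hM := hL.trans_le hle
    rw [normalised_root_eq_exp hM hV2 hβ hk]
  · simp only [Function.comp_apply]
    rw [← dobinskiExponent_eq hV2 hχ hk hmk]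
    gcongr
  · rw [← upperExponent_eq hV2 hβ hχe hk]
    have hge := weightedBell_two_mul_le hV2 hVeven hVodd hβ (by positivity : 0 ≤ χ * k) k
    gcongr

end
end
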